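/- arXiv:math-ph/0605037 — 7 statements merged into one kernel-verified Lean document; each statement's English description precedes it below -/
import Mathlib

section
/- Suppose that for each m ∈ {1,…,d} a scattering solution φ^{(m)} of the star-graph problem exists, with scattering matrix T = [t_{n,m}]. Let φ be any solution of the star-graph problem and let α, β ∈ ℂ^d be such that φ_n(s) = α_n e^{iks} + β_n e^{−iks} for all s ≥ 1. Define the limiting function φ̃ by φ̃_n(s) = α_n e^{iks} + β_n e^{−iks} for all s ≥ 0, and let φ̂(0) = (φ̃_1(0),…,φ̃_d(0)) and φ̂'(0) = (φ̃_1'(0),…,φ̃_d'(0)) be the corresponding vectors of values and derivatives at the vertex. Then the gluing condition (i/k)(I + T)·φ̂'(0) − (I − T)·φ̂(0) = 0 holds, where I is the d×d identity matrix. -/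
open scoped BigOperators
open Set

/-- `φ` is a solution of the star-graph problem with data `B` and wavenumber `k`. -/
def IsStarSolution (d : ℕ) (B : Fin d → ℝ → ℝ) (k : ℝ) (φ : Fin d → ℝ → ℂ) : Prop :=
  (∀ n, ContDiffOn ℝ 2 (φ n) (Ici 0)) ∧
  (∀ n, ∀ s ∈ Ioi (0 : ℝ),
      -(deriv (deriv (φ n)) s) + (B n s : ℂ) * φ n s = (k : ℂ) ^ 2 * φ n s) ∧
  (∀ n n' : Fin d, φ n 0 = φ n' 0) ∧
  (∑ n, derivWithin (φ n) (Ici 0) 0 = 0)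

/-- `φ` is a scattering solution with incoming edge `m` and coefficients `t n = t_{n,m}`. -/
def IsScatteringSolution (d : ℕ) (B : Fin d → ℝ → ℝ) (k : ℝ)
    (m : Fin d) (t : Fin d → ℂ) (φ : Fin d → ℝ → ℂ) : Prop :=
  IsStarSolution d B k φ ∧
  ∀ n, ∀ s : ℝ, 1 ≤ s →
    φ n s = (if n = m then 1 else 0) * Complex.exp (-(Complex.I * k * s))
            + t n * Complex.exp (Complex.I * k * s)

theorem star_aux_diff {f : ℝ → ℂ} (hf : ContDiffOn ℝ 2 f (Ici 0)) {s : ℝ} (hs : 0 < s) :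
    DifferentiableAt ℝ f s ∧ DifferentiableAt ℝ (deriv f) s := by
  have h1 : ContDiffOn ℝ 2 f (Ioi 0) := hf.mono Ioi_subset_Ici_self
  have h2 : ContDiffOn ℝ 1 (deriv f) (Ioi 0) := h1.deriv_of_isOpen isOpen_Ioi (by norm_num)
  exact ⟨(h1.differentiableOn (by norm_num)).differentiableAt (Ioi_mem_nhds hs),
    (h2.differentiableOn (by norm_num)).differentiableAt (Ioi_mem_nhds hs)⟩

theorem star_aux_lin {d : ℕ} {B : Fin d → ℝ → ℝ} {k : ℝ} {φ ψ : Fin d → ℝ → ℂ} (c : ℂ)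
    (hφ : IsStarSolution d B k φ) (hψ : IsStarSolution d B k ψ) :
    IsStarSolution d B k (fun n s => φ n s - c * ψ n s) := by
  obtain ⟨a1, a2, a3, a4⟩ := hφ
  obtain ⟨b1, b2, b3, b4⟩ := hψ
  refine ⟨fun n => (a1 n).sub (contDiffOn_const.mul (b1 n)), ?_, ?_, ?_⟩
  · intro n s hs
    have e : deriv (fun s => φ n s - c * ψ n s) =ᶠ[nhds s]
        fun s => deriv (φ n) s - c * deriv (ψ n) s := by
      filter_upwards [Ioi_mem_nhds hs] with x hx
      have h1 := (star_aux_diff (a1 n) hx).1.hasDerivAt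
      have h2 := (star_aux_diff (b1 n) hx).1.hasDerivAt
      exact (h1.sub (h2.const_mul c)).deriv
    have h1 := (star_aux_diff (a1 n) hs).2.hasDerivAt
    have h2 := (star_aux_diff (b1 n) hs).2.hasDerivAt
    have h3 : deriv (fun s => deriv (φ n) s - c * deriv (ψ n) s) s = _ :=
      (h1.sub (h2.const_mul c)).deriv
    rw [e.deriv_eq, h3]
    linear_combination a2 n s hs - c * b2 n s hs
  · intro n n'
    simp only [a3 n n', b3 n n']
  · have h : ∀ n, derivWithin (fun s => φ n s - c * ψ n s) (Ici 0) 0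
        = derivWithin (φ n) (Ici 0) 0 - c * derivWithin (ψ n) (Ici 0) 0 := by
      intro n
      have h1 := ((a1 n).differentiableOn (by norm_num) 0 self_mem_Ici).hasDerivWithinAt
      have h2 := ((b1 n).differentiableOn (by norm_num) 0 self_mem_Ici).hasDerivWithinAt
      exact (h1.sub (h2.const_mul c)).derivWithin (uniqueDiffOn_Ici 0 0 self_mem_Ici)
    simp only [h, Finset.sum_sub_distrib, ← Finset.mul_sum, a4, b4]
    simp

theorem star_aux_sum {d : ℕ} {B : Fin d → ℝ → ℝ} {k : ℝ} {φ : Fin d → ℝ → ℂ}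
    {Φ : Fin d → Fin d → ℝ → ℂ} (β : Fin d → ℂ)
    (hφ : IsStarSolution d B k φ) (hΦ : ∀ m, IsStarSolution d B k (Φ m)) (S : Finset (Fin d)) :
    IsStarSolution d B k (fun n s => φ n s - ∑ m ∈ S, β m * Φ m n s) := by
  induction S using Finset.induction_on with
  | empty => simpa using hφ
  | insert a S ha ih =>
    have := star_aux_lin (β a) ih (hΦ a)
    convert this using 3
    rw [Finset.sum_insert ha]
    ring

theorem star_aux_exp (c : ℂ) (k s : ℝ) :
    HasDerivAt (fun s : ℝ => c * Complex.exp (Complex.I * k * s))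
      (c * (Complex.exp (Complex.I * k * s) * (Complex.I * k))) s := by
  have h0 : HasDerivAt (fun s : ℝ => Complex.I * k * (s : ℂ)) (Complex.I * k) s := by
    simpa using (Complex.ofRealCLM.hasDerivAt (x := s)).const_mul (Complex.I * (k : ℂ))
  exact h0.cexp.const_mul c

theorem star_aux_wronskian {f : ℝ → ℂ} {B : ℝ → ℝ} {k : ℝ} {c : ℂ}
    (hf : ContDiffOn ℝ 2 f (Ici 0))
    (hode : ∀ s ∈ Ioi (0 : ℝ), -(deriv (deriv f) s) + (B s : ℂ) * f s = (k : ℂ) ^ 2 * f s)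
    (hc : ∀ s : ℝ, 1 ≤ s → f s = c * Complex.exp (Complex.I * k * s)) :
    (star (f 0) * derivWithin f (Ici 0) 0).im = k * Complex.normSq c := by
  set W : ℝ → ℝ := fun s => (star (f s) * derivWithin f (Ici 0) s).im with hW
  have hcont : ContinuousOn W (Icc 0 2) := by
    have h1 : ContinuousOn f (Icc 0 2) := hf.continuousOn.mono Icc_subset_Ici_self
    have h2 : ContinuousOn (derivWithin f (Ici 0)) (Icc 0 2) :=
      (hf.continuousOn_derivWithin (uniqueDiffOn_Ici 0) (by norm_num)).mono Icc_subset_Ici_self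
    exact Complex.continuous_im.comp_continuousOn (h1.star.mul h2)
  have hev : ∀ s : ℝ, 0 < s → derivWithin f (Ici 0) s = deriv f s := fun s hs =>
    derivWithin_of_mem_nhds (Ici_mem_nhds hs)
  have hder : ∀ s ∈ Ioo (0:ℝ) 2, HasDerivAt W 0 s := by
    intro s hs
    have h1 := (star_aux_diff hf hs.1).1.hasDerivAt
    have h2 := (star_aux_diff hf hs.1).2.hasDerivAt
    have h3 := (h1.star.mul h2)
    have h4 := (Complex.imCLM.hasFDerivAt.comp_hasDerivAt s h3)
    have h5 : HasDerivAt W _ s := h4.congr_of_eventuallyEq (by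
      filter_upwards [Ioi_mem_nhds hs.1] with x hx
      simp [hW, hev x hx])
    convert h5 using 1
    have e : deriv (deriv f) s = ((B s - k ^ 2 : ℝ) : ℂ) * f s := by
      push_cast
      linear_combination - hode s hs.1
    rw [e]
    simp only [Complex.imCLM_apply, Complex.add_im, Complex.mul_im, Complex.mul_re,
      Complex.star_def, Complex.conj_re, Complex.conj_im, Complex.ofReal_re, Complex.ofReal_im]
    ring
  have hconst : W 2 = W 0 := by
    obtain ⟨x, hx, h⟩ := exists_hasDerivAt_eq_slope W (fun _ => 0) (by norm_num : (0:ℝ) < 2)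
      hcont hder
    have : W 2 - W 0 = 0 := by
      field_simp at h
      linarith
    linarith
  change W 0 = _
  rw [← hconst]
  simp only [hW]
  have hd : deriv f 2 = c * (Complex.exp (Complex.I * k * (2:ℝ)) * (Complex.I * k)) := by
    rw [← (star_aux_exp c k 2).deriv]
    apply Filter.EventuallyEq.deriv_eq
    filter_upwards [Ici_mem_nhds (by norm_num : (1:ℝ) < 2)] with x hx using hc x hx
  rw [hev 2 (by norm_num), hd, hc 2 (by norm_num)]
  set E := Complex.exp (Complex.I * k * (2:ℝ)) with hE
  have hE1 : Complex.normSq E = 1 := by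
    rw [Complex.normSq_eq_norm_sq, hE, Complex.norm_exp]
    simp
  have : star (c * E) * (c * (E * (Complex.I * k))) =
      ((k * (Complex.normSq c * Complex.normSq E) : ℝ) : ℂ) * Complex.I := by
    push_cast
    rw [← Complex.mul_conj, ← Complex.mul_conj, Complex.star_def, map_mul]
    ring
  rw [this, hE1, Complex.im_ofReal_mul, Complex.I_im, mul_one, mul_one]

theorem star_aux_out {d : ℕ} {B : Fin d → ℝ → ℝ} {k : ℝ} (hk : 0 < k) {ψ : Fin d → ℝ → ℂ}
    (hψ : IsStarSolution d B k ψ) (γ : Fin d → ℂ)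
    (hγ : ∀ n, ∀ s : ℝ, 1 ≤ s → ψ n s = γ n * Complex.exp (Complex.I * k * s)) (n : Fin d) :
    γ n = 0 := by
  obtain ⟨a1, a2, a3, a4⟩ := hψ
  have h : ∑ j, k * Complex.normSq (γ j) = 0 := by
    have h1 : ∀ j, k * Complex.normSq (γ j)
        = (star (ψ n 0) * derivWithin (ψ j) (Ici 0) 0).im := fun j => by
      rw [a3 n j]
      exact (star_aux_wronskian (a1 j) (a2 j) (hγ j)).symm
    rw [Finset.sum_congr rfl fun j _ => h1 j, ← Complex.im_sum, ← Finset.mul_sum, a4]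
    simp
  have h2 := (Finset.sum_eq_zero_iff_of_nonneg
    (fun j _ => mul_nonneg hk.le (Complex.normSq_nonneg (γ j)))).1 h n (Finset.mem_univ n)
  exact Complex.normSq_eq_zero.1 ((mul_eq_zero.1 h2).resolve_left hk.ne')

/-- Suppose that for each `m` a scattering solution exists, with scattering matrix
`T = [t_{n,m}]`.  Let `φ` be any solution of the star-graph problem with
`φ n s = α n e^{iks} + β n e^{−iks}` for `s ≥ 1`, and let
`φ̃ n s = α n e^{iks} + β n e^{−iks}` (for all `s ≥ 0`) be the limiting function.  Then the
gluing condition `(i/k)(I + T)·φ̂'(0) − (I − T)·φ̂(0) = 0` holds, where `φ̂(0)` and `φ̂'(0)`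
are the vectors of values and derivatives of `φ̃` at the vertex. -/
theorem limiting_function_gluing_condition
    (d : ℕ) (hd : 2 ≤ d) (k : ℝ) (hk : 0 < k)
    (B : Fin d → ℝ → ℝ) (hBcont : ∀ n, Continuous (B n))
    (hBsupp : ∀ n, ∀ s : ℝ, s ∉ Icc (0 : ℝ) 1 → B n s = 0)
    (Φ : Fin d → Fin d → ℝ → ℂ) (T : Matrix (Fin d) (Fin d) ℂ)
    (hΦ : ∀ m, IsScatteringSolution d B k m (fun n => T n m) (Φ m))
    (φ : Fin d → ℝ → ℂ) (hφ : IsStarSolution d B k φ)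
    (α β : Fin d → ℂ)
    (hαβ : ∀ n, ∀ s : ℝ, 1 ≤ s →
      φ n s = α n * Complex.exp (Complex.I * k * s)
              + β n * Complex.exp (-(Complex.I * k * s))) :
    (Complex.I / k) •
        (1 + T).mulVec (fun n =>
          deriv (fun s : ℝ => α n * Complex.exp (Complex.I * k * s)
              + β n * Complex.exp (-(Complex.I * k * s))) 0)
      - (1 - T).mulVec (fun n =>
          α n * Complex.exp (Complex.I * k * (0 : ℝ))
              + β n * Complex.exp (-(Complex.I * k * (0 : ℝ)))) = 0 := by
  have hα : α = T.mulVec β := by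
    funext n
    have hs := star_aux_sum β hφ (fun m => (hΦ m).1) Finset.univ
    have := star_aux_out hk hs (fun n => α n - T.mulVec β n) (by
      intro n s hs
      have h1 : ∀ m, β m * Φ m n s = (if n = m then β m * Complex.exp (-(Complex.I * k * s)) else 0)
          + T n m * β m * Complex.exp (Complex.I * k * s) := by
        intro m
        rw [(hΦ m).2 n s hs]
        split_ifs <;> ring
      simp only [h1, Finset.sum_add_distrib, hαβ n s hs, Matrix.mulVec, dotProduct,
        ← Finset.sum_mul, Finset.sum_ite_eq, Finset.mem_univ, if_true]
      ring) n
    exact sub_eq_zero.1 this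
  have hd0 : ∀ n, deriv (fun s : ℝ => α n * Complex.exp (Complex.I * k * s)
              + β n * Complex.exp (-(Complex.I * k * s))) 0
      = (Complex.I * k) * (α n - β n) := by
    intro n
    have h1 := star_aux_exp (α n) k 0
    have h2 := star_aux_exp (β n) (-k) 0
    have h3 := (h1.add h2).deriv
    have e : (fun s : ℝ => α n * Complex.exp (Complex.I * k * s)
              + β n * Complex.exp (-(Complex.I * k * s))) =
        (fun s : ℝ => α n * Complex.exp (Complex.I * k * s)) +
        (fun s : ℝ => β n * Complex.exp (Complex.I * (-k : ℝ) * s)) := by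
      funext s
      simp
    rw [e, h3]
    simp
    ring
  have hkc : (k : ℂ) ≠ 0 := by exact_mod_cast hk.ne'
  have e1 : (fun n => deriv (fun s : ℝ => α n * Complex.exp (Complex.I * k * s)
              + β n * Complex.exp (-(Complex.I * k * s))) 0)
      = (Complex.I * k) • (α - β) := by
    funext n
    rw [hd0 n]
    simp
  have e2 : (fun n => α n * Complex.exp (Complex.I * k * (0 : ℝ))
              + β n * Complex.exp (-(Complex.I * k * (0 : ℝ)))) = α + β := by
    funext n
    simp
  have e3 : Complex.I / k * (Complex.I * k) = -1 := by
    field_simp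
    simp
  rw [e1, e2, Matrix.mulVec_smul, smul_smul, e3, Matrix.add_mulVec, Matrix.sub_mulVec,
    Matrix.mulVec_sub, Matrix.mulVec_sub, Matrix.mulVec_add, Matrix.mulVec_add, ← hα,
    Matrix.one_mulVec, Matrix.one_mulVec]
  module
end

section
/- Suppose that for each m ∈ {1,…,d} a scattering solution φ^{(m)} of the star-graph problem exists, with scattering matrix T = [t_{n,m}]. Then T is unitary: for all m₁, m₂ ∈ {1,…,d}, Σ_{n=1}^d t_{n,m₁}·conj(t_{n,m₂}) = δ_{m₁,m₂}. -/
open scoped BigOperators ComplexConjugate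
open Set

lemma aux_deriv {f : ℝ → ℂ} {s : ℝ} (hs : 0 < s) : derivWithin f (Ici 0) s = deriv f s :=
  derivWithin_of_mem_nhds (Ici_mem_nhds hs)

lemma aux_d1 {f : ℝ → ℂ} (hf : ContDiffOn ℝ 2 f (Ici 0)) {s : ℝ} (hs : 0 < s) :
    HasDerivAt f (derivWithin f (Ici 0) s) s := by
  rw [aux_deriv hs]
  exact ((hf.differentiableOn (by norm_num) s hs.le).differentiableAt
    (Ici_mem_nhds hs)).hasDerivAt

lemma aux_C1 {f : ℝ → ℂ} (hf : ContDiffOn ℝ 2 f (Ici 0)) :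
    ContDiffOn ℝ 1 (derivWithin f (Ici 0)) (Ici 0) :=
  hf.derivWithin (uniqueDiffOn_Ici 0) (by norm_num)

lemma aux_d2 {f : ℝ → ℂ} (hf : ContDiffOn ℝ 2 f (Ici 0)) {s : ℝ} (hs : 0 < s) :
    HasDerivAt (derivWithin f (Ici 0)) (deriv (deriv f) s) s := by
  have h := (((aux_C1 hf).differentiableOn (by norm_num) s hs.le).differentiableAt
    (Ici_mem_nhds hs)).hasDerivAt
  have e : derivWithin f (Ici 0) =ᶠ[nhds s] deriv f := by
    filter_upwards [Ioi_mem_nhds hs] with x hx using aux_deriv hx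
  rwa [e.deriv_eq] at h

lemma aux_wronskian {f g : ℝ → ℂ} {b : ℝ → ℝ} {k : ℝ}
    (hf : ContDiffOn ℝ 2 f (Ici 0)) (hg : ContDiffOn ℝ 2 g (Ici 0))
    (ef : ∀ s ∈ Ioi (0 : ℝ), -(deriv (deriv f) s) + (b s : ℂ) * f s = (k : ℂ) ^ 2 * f s)
    (eg : ∀ s ∈ Ioi (0 : ℝ), -(deriv (deriv g) s) + (b s : ℂ) * g s = (k : ℂ) ^ 2 * g s) :
    f 2 * conj (derivWithin g (Ici 0) 2) - derivWithin f (Ici 0) 2 * conj (g 2) =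
    f 0 * conj (derivWithin g (Ici 0) 0) - derivWithin f (Ici 0) 0 * conj (g 0) := by
  have hsub : Icc (0:ℝ) 2 ⊆ Ici 0 := Icc_subset_Ici_self
  have c1 := hf.continuousOn.mono hsub
  have c2 := hg.continuousOn.mono hsub
  have c3 := (aux_C1 hf).continuousOn.mono hsub
  have c4 := (aux_C1 hg).continuousOn.mono hsub
  have cc := Complex.continuous_conj
  have hc : ContinuousOn (fun s => f s * conj (derivWithin g (Ici 0) s)
      - derivWithin f (Ici 0) s * conj (g s)) (Icc 0 2) :=
    (c1.mul (cc.comp_continuousOn c4)).sub (c3.mul (cc.comp_continuousOn c2))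
  have key := intervalIntegral.integral_eq_sub_of_hasDeriv_right_of_le
    (f' := fun _ => 0) (by norm_num : (0:ℝ) ≤ 2) hc ?_ (by simp)
  · simp only [intervalIntegral.integral_zero] at key
    exact sub_eq_zero.mp key.symm
  · intro s hs
    have h := ((aux_d1 hf hs.1).mul ((aux_d2 hg hs.1).star)).sub
      ((aux_d2 hf hs.1).mul ((aux_d1 hg hs.1).star))
    refine HasDerivAt.hasDerivWithinAt ?_
    refine HasDerivAt.congr_deriv h ?_
    have e1 : deriv (deriv f) s = (b s : ℂ) * f s - (k : ℂ) ^ 2 * f s := by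
      linear_combination -(ef s hs.1)
    have e2 : deriv (deriv g) s = (b s : ℂ) * g s - (k : ℂ) ^ 2 * g s := by
      linear_combination -(eg s hs.1)
    rw [e1, e2]
    simp
    ring

lemma aux_end {f : ℝ → ℂ} {k : ℝ} {a t : ℂ}
    (h : ∀ s : ℝ, 1 ≤ s → f s = a * Complex.exp (-(Complex.I * k * s))
            + t * Complex.exp (Complex.I * k * s)) :
    derivWithin f (Ici 0) 2 = Complex.I * k * (-a * Complex.exp (-(Complex.I * k * (2:ℝ)))
      + t * Complex.exp (Complex.I * k * (2:ℝ))) := by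
  rw [aux_deriv (by norm_num)]
  have e : f =ᶠ[nhds 2] fun s : ℝ => a * Complex.exp (-(Complex.I * k * s))
            + t * Complex.exp (Complex.I * k * s) := by
    filter_upwards [Ioi_mem_nhds (by norm_num : (1:ℝ) < 2)] with x hx using h x (le_of_lt hx)
  rw [e.deriv_eq]
  have h1 : HasDerivAt (fun s : ℝ => Complex.I * k * (s:ℂ)) (Complex.I * k * 1) 2 :=
    (HasDerivAt.ofReal_comp (hasDerivAt_id (2:ℝ))).const_mul _
  have h2 := ((h1.neg.cexp).const_mul a).add ((h1.cexp).const_mul t)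
  refine (HasDerivAt.congr_deriv h2 ?_).deriv
  simp
  ring

lemma aux_edge {f g : ℝ → ℂ} {b : ℝ → ℝ} {k : ℝ} {a t a' t' : ℂ}
    (hf : ContDiffOn ℝ 2 f (Ici 0)) (hg : ContDiffOn ℝ 2 g (Ici 0))
    (ef : ∀ s ∈ Ioi (0 : ℝ), -(deriv (deriv f) s) + (b s : ℂ) * f s = (k : ℂ) ^ 2 * f s)
    (eg : ∀ s ∈ Ioi (0 : ℝ), -(deriv (deriv g) s) + (b s : ℂ) * g s = (k : ℂ) ^ 2 * g s)
    (h : ∀ s : ℝ, 1 ≤ s → f s = a * Complex.exp (-(Complex.I * k * s))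
            + t * Complex.exp (Complex.I * k * s))
    (h' : ∀ s : ℝ, 1 ≤ s → g s = a' * Complex.exp (-(Complex.I * k * s))
            + t' * Complex.exp (Complex.I * k * s)) :
    f 0 * conj (derivWithin g (Ici 0) 0) - derivWithin f (Ici 0) 0 * conj (g 0) =
    -2 * Complex.I * k * (t * conj t' - a * conj a') := by
  rw [← aux_wronskian hf hg ef eg, aux_end h, aux_end h', h 2 (by norm_num), h' 2 (by norm_num)]
  have hE : Complex.exp (-(Complex.I * k * (2:ℝ))) * Complex.exp (Complex.I * k * (2:ℝ)) = 1 := by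
    rw [← Complex.exp_add]; simp
  have c1 : conj (Complex.exp (Complex.I * k * (2:ℝ))) = Complex.exp (-(Complex.I * k * (2:ℝ))) := by
    rw [← Complex.exp_conj]
    simp only [map_mul, Complex.conj_I, Complex.conj_ofReal]
    congr 1; ring
  have c2 : conj (Complex.exp (-(Complex.I * k * (2:ℝ)))) = Complex.exp (Complex.I * k * (2:ℝ)) := by
    rw [← c1, Complex.conj_conj]
  simp only [map_mul, map_add, map_neg, c1, c2, Complex.conj_I, Complex.conj_ofReal]
  generalize Complex.exp (-(Complex.I * k * (2:ℝ))) = E' at *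
  generalize Complex.exp (Complex.I * k * (2:ℝ)) = E at *
  linear_combination (-2 * Complex.I * k * (t * conj t' - a * conj a')) * hE

/-- If for each `m` a scattering solution exists, with scattering matrix `T = [t_{n,m}]`,
then `T` is unitary: `∑ₙ t_{n,m₁}·conj(t_{n,m₂}) = δ_{m₁,m₂}`. -/
theorem scattering_matrix_unitary
    (d : ℕ) (hd : 2 ≤ d) (k : ℝ) (hk : 0 < k)
    (B : Fin d → ℝ → ℝ) (hBcont : ∀ n, Continuous (B n))
    (hBsupp : ∀ n, ∀ s : ℝ, s ∉ Icc (0 : ℝ) 1 → B n s = 0)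
    (Φ : Fin d → Fin d → ℝ → ℂ) (T : Matrix (Fin d) (Fin d) ℂ)
    (hΦ : ∀ m, IsScatteringSolution d B k m (fun n => T n m) (Φ m)) :
    ∀ m₁ m₂ : Fin d,
      ∑ n, T n m₁ * conj (T n m₂) = if m₁ = m₂ then 1 else 0 := by
  intro m₁ m₂
  obtain ⟨⟨f1, f2, f3, f4⟩, f5⟩ := hΦ m₁
  obtain ⟨⟨g1, g2, g3, g4⟩, g5⟩ := hΦ m₂
  have key := fun n => aux_edge (f1 n) (g1 n) (f2 n) (g2 n) (f5 n) (g5 n)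
  have hs := Finset.sum_congr (rfl : (Finset.univ : Finset (Fin d)) = Finset.univ)
    (fun n _ => key n)
  let z : Fin d := ⟨0, by omega⟩
  have hz : ∑ n, (Φ m₁ n 0 * conj (derivWithin (Φ m₂ n) (Ici 0) 0)
      - derivWithin (Φ m₁ n) (Ici 0) 0 * conj (Φ m₂ n 0)) = 0 := by
    simp_rw [fun n => f3 n z, fun n => g3 n z]
    rw [Finset.sum_sub_distrib, ← Finset.mul_sum, ← Finset.sum_mul, ← map_sum, f4, g4]
    simp
  rw [hz, ← Finset.mul_sum, Finset.sum_sub_distrib] at hs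
  have hk' : (-2 * Complex.I * k : ℂ) ≠ 0 := by
    simp [hk.ne']
  have h0 := (mul_eq_zero.mp hs.symm).resolve_left hk'
  rw [sub_eq_zero] at h0
  rw [h0]
  simp [apply_ite, eq_comm]
end

section
/- Suppose that for each m ∈ {1,…,d} a scattering solution φ^{(m)} of the star-graph problem exists, with scattering matrix T = [t_{n,m}]. Then T is symmetric: t_{n,m} = t_{m,n} for all n, m ∈ {1,…,d}. -/
open scoped BigOperators ComplexConjugate
open Set

theorem wronskian_const (q : ℝ → ℂ) (f g : ℝ → ℂ)
    (hf : ContDiffOn ℝ 2 f (Ici 0)) (hg : ContDiffOn ℝ 2 g (Ici 0))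
    (hf2 : ∀ s ∈ Ioi (0 : ℝ), deriv (deriv f) s = q s * f s)
    (hg2 : ∀ s ∈ Ioi (0 : ℝ), deriv (deriv g) s = q s * g s) :
    f 0 * derivWithin g (Ici 0) 0 - g 0 * derivWithin f (Ici 0) 0
      = f 2 * deriv g 2 - g 2 * deriv f 2 := by
  have hu : UniqueDiffOn ℝ (Ici (0 : ℝ)) := uniqueDiffOn_Ici 0
  have key : ∀ h : ℝ → ℂ, ContDiffOn ℝ 2 h (Ici 0) →
      ContinuousOn h (Icc 0 2) ∧ ContinuousOn (derivWithin h (Ici 0)) (Icc 0 2) ∧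
      (∀ s ∈ Ioi (0 : ℝ), derivWithin h (Ici 0) s = deriv h s) ∧
      (∀ s ∈ Ioi (0 : ℝ), HasDerivAt h (derivWithin h (Ici 0) s) s) ∧
      (∀ s ∈ Ioi (0 : ℝ), HasDerivAt (derivWithin h (Ici 0)) (deriv (deriv h) s) s) := by
    intro h hh
    have hw : ∀ s ∈ Ioi (0 : ℝ), derivWithin h (Ici 0) s = deriv h s :=
      fun s hs => derivWithin_of_mem_nhds (Ici_mem_nhds hs)
    have h1 : ContDiffOn ℝ 1 (derivWithin h (Ici 0)) (Ici 0) :=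
      hh.derivWithin hu (by norm_num)
    refine ⟨hh.continuousOn.mono Icc_subset_Ici_self,
      h1.continuousOn.mono Icc_subset_Ici_self, hw, ?_, ?_⟩
    · intro s hs
      rw [hw s hs]
      exact ((hh.differentiableOn (by norm_num)).differentiableAt
        (Ici_mem_nhds hs)).hasDerivAt
    · intro s hs
      have he : derivWithin h (Ici 0) =ᶠ[nhds s] deriv h := by
        filter_upwards [Ioi_mem_nhds hs] with x hx using hw x hx
      rw [← he.deriv_eq]
      exact ((h1.differentiableOn (by norm_num)).differentiableAt
        (Ici_mem_nhds hs)).hasDerivAt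
  obtain ⟨f1, f2, f3, f4, f5⟩ := key f hf
  obtain ⟨g1, g2, g3, g4, g5⟩ := key g hg
  have := intervalIntegral.integral_eq_sub_of_hasDerivAt_of_le (a := 0) (b := 2)
    (f := fun s => f s * derivWithin g (Ici 0) s - g s * derivWithin f (Ici 0) s)
    (f' := fun _ => 0) (by norm_num) ((f1.mul g2).sub (g1.mul f2))
    (by
      intro s hs
      have h := ((f4 s hs.1).mul (g5 s hs.1)).sub ((g4 s hs.1).mul (f5 s hs.1))
      refine h.congr_deriv ?_
      rw [hf2 s hs.1, hg2 s hs.1]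
      ring) (by simp)
  simp only [intervalIntegral.integral_zero] at this
  rw [g3 2 (by simp), f3 2 (by simp)] at this
  exact (sub_eq_zero.mp this.symm).symm

theorem deriv_at_two (k : ℝ) (a t : ℂ) (f : ℝ → ℂ)
    (h : ∀ s : ℝ, 1 ≤ s → f s = a * Complex.exp (-(Complex.I * k * s))
            + t * Complex.exp (Complex.I * k * s)) :
    deriv f 2 = Complex.I * k * (- a * Complex.exp (-(Complex.I * k * (2 : ℝ)))
            + t * Complex.exp (Complex.I * k * (2 : ℝ))) := by
  have he : f =ᶠ[nhds 2] fun s : ℝ => a * Complex.exp (-(Complex.I * k * s))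
            + t * Complex.exp (Complex.I * k * s) := by
    filter_upwards [Ioi_mem_nhds (show (1 : ℝ) < 2 by norm_num)] with x hx using h x (le_of_lt hx)
  rw [he.deriv_eq]
  have h0 : HasDerivAt (fun s : ℝ => Complex.I * k * (s : ℂ)) (Complex.I * k) 2 := by
    simpa using (Complex.ofRealCLM.hasDerivAt (x := (2 : ℝ))).const_mul (Complex.I * (k : ℂ))
  have h1 := (h0.neg.cexp.const_mul a).add (h0.cexp.const_mul t)
  refine (h1.congr_deriv ?_).deriv
  simp only [Pi.neg_apply]
  ring

/-- If for each `m` a scattering solution exists, with scattering matrix `T = [t_{n,m}]`,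
then `T` is symmetric: `t_{n,m} = t_{m,n}` for all `n, m`. -/
theorem scattering_matrix_symmetric
    (d : ℕ) (hd : 2 ≤ d) (k : ℝ) (hk : 0 < k)
    (B : Fin d → ℝ → ℝ) (hBcont : ∀ n, Continuous (B n))
    (hBsupp : ∀ n, ∀ s : ℝ, s ∉ Icc (0 : ℝ) 1 → B n s = 0)
    (Φ : Fin d → Fin d → ℝ → ℂ) (T : Matrix (Fin d) (Fin d) ℂ)
    (hΦ : ∀ m, IsScatteringSolution d B k m (fun n => T n m) (Φ m)) :
    ∀ n m : Fin d, T n m = T m n := by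
  intro n m
  have hW : ∀ j, Φ m j 0 * derivWithin (Φ n j) (Ici 0) 0 - Φ n j 0 * derivWithin (Φ m j) (Ici 0) 0
      = 2 * Complex.I * k * ((if j = m then 1 else 0) * T j n
          - (if j = n then 1 else 0) * T j m) := by
    intro j
    obtain ⟨⟨a1, a2, -, -⟩, a3⟩ := hΦ m
    obtain ⟨⟨b1, b2, -, -⟩, b3⟩ := hΦ n
    rw [wronskian_const (fun s => (B j s : ℂ) - (k : ℂ) ^ 2) _ _ (a1 j) (b1 j)
      (fun s hs => by linear_combination -(a2 j s hs))
      (fun s hs => by linear_combination -(b2 j s hs)),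
      deriv_at_two k _ _ _ (a3 j), deriv_at_two k _ _ _ (b3 j),
      a3 j 2 (by norm_num), b3 j 2 (by norm_num)]
    have hE : Complex.exp (-(Complex.I * k * (2 : ℝ))) * Complex.exp (Complex.I * k * (2 : ℝ)) = 1 := by
      rw [← Complex.exp_add]; simp
    generalize Complex.exp (-(Complex.I * k * (2 : ℝ))) = x at hE ⊢
    generalize Complex.exp (Complex.I * k * (2 : ℝ)) = y at hE ⊢
    generalize (if j = m then (1 : ℂ) else 0) = p
    generalize (if j = n then (1 : ℂ) else 0) = r
    linear_combination (2 * Complex.I * k * (p * T j n - r * T j m)) * hE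
  have hS := Finset.sum_congr (rfl : (Finset.univ : Finset (Fin d)) = _) (fun j _ => hW j)
  obtain ⟨⟨-, -, a1, a2⟩, -⟩ := hΦ m
  obtain ⟨⟨-, -, b1, b2⟩, -⟩ := hΦ n
  have hL : ∑ j, (Φ m j 0 * derivWithin (Φ n j) (Ici 0) 0
      - Φ n j 0 * derivWithin (Φ m j) (Ici 0) 0) = 0 := by
    rw [Finset.sum_sub_distrib,
      Finset.sum_congr rfl (fun j _ => by rw [a1 j m]), ← Finset.mul_sum, b2]
    rw [Finset.sum_congr rfl (fun j _ => by rw [b1 j m]), ← Finset.mul_sum, a2]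
    simp
  rw [hL, ← Finset.mul_sum, Finset.sum_sub_distrib] at hS
  simp only [ite_mul, one_mul, zero_mul, Finset.sum_ite_eq', Finset.mem_univ, if_true] at hS
  have hk' : (2 * Complex.I * (k : ℂ)) ≠ 0 := by
    simp [hk.ne']
  have h0 := (mul_eq_zero.mp hS.symm).resolve_left hk'
  exact (sub_eq_zero.mp h0).symm
end

section
/- Let d ≥ 2, fix m ∈ {1,…,d}, and let r_1,…,r_d, t_1,…,t_d be complex numbers with |r_n|² + |t_n|² = 1, t_n ≠ 0 and 1 + r_n ≠ 0 for every n, and ρ := Σ_{j=1}^d (1 − r_j)/(1 + r_j) ≠ 0. Then the linear system γ_n(1 + r_n) = (1 + conj(r_m))/conj(t_m) + γ_m(1 + r_m) for all n ≠ m, together with (1 − conj(r_m))/conj(t_m) = Σ_{n=1}^d γ_n(1 − r_n), has a unique solution (γ_1,…,γ_d) ∈ ℂ^d, given by γ_m = 2t_m/((1 + r_m)²ρ) − (1 + conj(r_m))/(conj(t_m)(1 + r_m)) and γ_n = 2t_m/((1 + r_m)(1 + r_n)ρ) for n ≠ m. -/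
open scoped BigOperators ComplexConjugate

/-- The linear system arising from gluing line scattering solutions at the vertex of a
star graph has a unique solution `γ`, given by the explicit formulas of the paper. -/
theorem gluing_linear_system_unique_solution
    (d : ℕ) (hd : 2 ≤ d) (m : Fin d) (r t : Fin d → ℂ)
    (hnorm : ∀ n, ‖r n‖ ^ 2 + ‖t n‖ ^ 2 = 1)
    (ht : ∀ n, t n ≠ 0) (hr : ∀ n, 1 + r n ≠ 0)
    (ρ : ℂ) (hρdef : ρ = ∑ j, (1 - r j) / (1 + r j)) (hρ : ρ ≠ 0) :
    ∀ γ : Fin d → ℂ,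
      ((∀ n, n ≠ m →
          γ n * (1 + r n) = (1 + conj (r m)) / conj (t m) + γ m * (1 + r m)) ∧
        (1 - conj (r m)) / conj (t m) = ∑ n, γ n * (1 - r n))
      ↔ γ = fun n =>
          if n = m then
            2 * t m / ((1 + r m) ^ 2 * ρ) - (1 + conj (r m)) / (conj (t m) * (1 + r m))
          else
            2 * t m / ((1 + r m) * (1 + r n) * ρ) := by
  intro γ
  have hT : conj (t m) ≠ 0 := by simpa using ht m
  have hR := hr m
  have hkey : r m * conj (r m) + t m * conj (t m) = 1 := by
    rw [Complex.mul_conj, Complex.mul_conj, Complex.normSq_eq_norm_sq, Complex.normSq_eq_norm_sq]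
    exact_mod_cast hnorm m
  generalize conj (t m) = T at *
  generalize conj (r m) = c at *
  have hsum : ∀ (C : ℂ), (∀ n, γ n = C / (1 + r n) -
      (if n = m then (1 + c) / (T * (1 + r m)) else 0)) →
      ∑ n, γ n * (1 - r n) = C * ρ - (1 + c) / (T * (1 + r m)) * (1 - r m) := by
    intro C h
    have h2 : ∀ n, γ n * (1 - r n) = C * ((1 - r n) / (1 + r n)) -
        (if n = m then (1 + c) / (T * (1 + r m)) * (1 - r m) else 0) := by
      intro n
      rw [h n]
      by_cases hn : n = m
      · subst hn
        simp only [if_true]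
        ring
      · simp only [hn, if_false]
        ring
    rw [Finset.sum_congr rfl (fun n _ => h2 n), Finset.sum_sub_distrib, ← Finset.mul_sum,
      ← hρdef]
    simp
  constructor
  · rintro ⟨h1, h2⟩
    have h3 : ∀ n, γ n = ((1 + c) / T + γ m * (1 + r m)) / (1 + r n) -
      (if n = m then (1 + c) / (T * (1 + r m)) else 0) := by
      intro n
      by_cases hn : n = m
      · subst hn
        simp only [if_true]
        field_simp
        ring
      · simp only [hn, if_false, sub_zero]
        rw [← h1 n hn, mul_div_cancel_right₀ _ (hr n)]
    have h4 := hsum _ h3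
    have hC : (1 + c) / T + γ m * (1 + r m) = 2 * t m / ((1 + r m) * ρ) := by
      rw [← h2] at h4
      generalize (1 + c) / T + γ m * (1 + r m) = C at h4
      rw [eq_div_iff (mul_ne_zero hR hρ)]
      field_simp at h4
      apply mul_left_cancel₀ hT
      linear_combination -h4 - 2 * hkey
    funext n
    rw [h3 n, hC]
    have hn' := hr n
    by_cases hn : n = m
    · subst hn
      simp only [if_true]
      field_simp
    · simp only [hn, if_false]
      field_simp
      ring
  · intro h
    have h3 : ∀ n, γ n = (2 * t m / ((1 + r m) * ρ)) / (1 + r n) -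
      (if n = m then (1 + c) / (T * (1 + r m)) else 0) := by
      intro n
      rw [h]
      have hn' := hr n
      by_cases hn : n = m
      · subst hn
        simp only [if_true]
        field_simp
      · simp only [hn, if_false]
        field_simp
        ring
    refine ⟨?_, ?_⟩
    · intro n hn
      have hn' := hr n
      rw [h3 n, h3 m]
      simp only [hn, if_false, if_true]
      field_simp
      ring
    · rw [hsum _ h3]
      field_simp
      linear_combination -2 * hkey
end

section
/- For each n ∈ {1,…,d} let ψ_n be a twice continuously differentiable complex-valued function on ℝ solving −ψ_n'' + B_n ψ_n = k²ψ_n on ℝ with ψ_n(s) = e^{iks} + r_n e^{−iks} for s ≤ 0 and ψ_n(s) = t_n e^{iks} for s ≥ 1. Fix m ∈ {1,…,d} and assume t_n ≠ 0 and 1 + r_n ≠ 0 for all n, |r_n|² + |t_n|² = 1 for all n, and ρ := Σ_{j=1}^d (1 − r_j)/(1 + r_j) ≠ 0. Define φ^{(m)} on [0,∞) by φ^{(m)}_n(s) = γ_n ψ_n(s) for n ≠ m and φ^{(m)}_m(s) = (1/conj(t_m))·conj(ψ_m(s)) + γ_m ψ_m(s), where γ_n = 2t_m/((1 + r_m)(1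 + r_n)ρ) for n ≠ m and γ_m = 2t_m/((1 + r_m)²ρ) − (1 + conj(r_m))/(conj(t_m)(1 + r_m)). Then φ^{(m)} is a scattering solution of the star-graph problem with data (B_n) and wavenumber k, and its scattering coefficients are t_{n,m} = 2 t_m t_n/((1 + r_m)(1 + r_n)ρ) for n ≠ m and t_{m,m} = 2t_m²/((1 + r_m)²ρ) − t_m(1 + conj(r_m))/(conj(t_m)(1 + r_m)). -/
open scoped BigOperators ComplexConjugate
open Set

theorem aux_deriv_s12 (f : ℝ → ℂ) (a b : ℂ) (hf : Differentiable ℝ f) (s : ℝ) :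
    HasDerivAt (fun s => a * conj (f s) + b * f s)
      (a * conj (deriv f s) + b * deriv f s) s := by
  have h := (hf s).hasDerivAt
  have h2 : HasDerivAt (fun s => conj (f s)) (conj (deriv f s)) s := h.star
  exact (h2.const_mul a).add (h.const_mul b)

theorem aux_left (f : ℝ → ℂ) (k : ℝ) (r : ℂ) (hf : Differentiable ℝ f)
    (hleft : ∀ s : ℝ, s ≤ 0 →
      f s = Complex.exp (Complex.I * k * s) + r * Complex.exp (-(Complex.I * k * s))) :
    deriv f 0 = Complex.I * k * (1 - r) := by
  have hu : UniqueDiffWithinAt ℝ (Iic (0:ℝ)) 0 := uniqueDiffOn_Iic 0 0 (by simp)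
  have h1 := (hf 0).hasDerivAt.hasDerivWithinAt (s := Iic 0)
  have h0 : HasDerivAt (fun s : ℝ => Complex.I * k * (s : ℂ)) (Complex.I * k * 1) 0 :=
    (Complex.ofRealCLM.hasDerivAt (x := (0:ℝ))).const_mul (Complex.I * (k:ℂ))
  have h2 := (h0.cexp.add (h0.neg.cexp.const_mul r)).hasDerivWithinAt (s := Iic 0)
  have h3 := h2.congr (f₁ := f) (fun x hx => hleft x hx) (hleft 0 le_rfl)
  rw [hu.eq_deriv _ h1 h3]
  simp
  ring

theorem aux_star (d : ℕ) (k : ℝ) (B : Fin d → ℝ → ℝ)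
    (ψ : Fin d → ℝ → ℂ) (hψreg : ∀ n, ContDiff ℝ 2 (ψ n))
    (hψode : ∀ n, ∀ s : ℝ,
      -(deriv (deriv (ψ n)) s) + (B n s : ℂ) * ψ n s = (k : ℂ) ^ 2 * ψ n s)
    (a b : Fin d → ℂ)
    (hc : ∀ n n', a n * conj (ψ n 0) + b n * ψ n 0 = a n' * conj (ψ n' 0) + b n' * ψ n' 0)
    (hs : ∑ n, (a n * conj (deriv (ψ n) 0) + b n * deriv (ψ n) 0) = 0) :
    IsStarSolution d B k (fun n s => a n * conj (ψ n s) + b n * ψ n s) := by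
  have hd1 : ∀ n, Differentiable ℝ (ψ n) := fun n => (hψreg n).differentiable (by norm_num)
  have hd2 : ∀ n, Differentiable ℝ (deriv (ψ n)) := fun n =>
    ((contDiff_succ_iff_deriv (n := 1)).1 (by simpa [one_add_one_eq_two] using hψreg n)).2.2.differentiable
      (by norm_num)
  refine ⟨fun n => ?_, fun n s _ => ?_, hc, ?_⟩
  · have h2 : ContDiff ℝ 2 (fun s => conj (ψ n s)) :=
      Complex.conjCLE.contDiff.comp (hψreg n)
    exact ((contDiff_const.mul h2).add (contDiff_const.mul (hψreg n))).contDiffOn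
  · have e1 : deriv (fun s => a n * conj (ψ n s) + b n * ψ n s)
        = fun s => a n * conj (deriv (ψ n) s) + b n * deriv (ψ n) s :=
      funext fun s => (aux_deriv_s12 (ψ n) (a n) (b n) (hd1 n) s).deriv
    have e2 := (aux_deriv_s12 (deriv (ψ n)) (a n) (b n) (hd2 n) s).deriv
    have h := hψode n s
    have h' := congrArg conj h
    simp only [map_add, map_neg, map_mul, map_pow, Complex.conj_ofReal] at h'
    simp only [e1, e2]
    linear_combination a n * h' + b n * h
  · rw [← hs]
    refine Finset.sum_congr rfl fun n _ => ?_
    exact (aux_deriv_s12 (ψ n) (a n) (b n) (hd1 n) 0).hasDerivWithinAt.derivWithin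
      (uniqueDiffOn_Ici 0 0 (by simp))

/-- Gluing `d` line scattering solutions `ψₙ` (with reflection coefficients `rₙ` and
transmission coefficients `tₙ`) with the explicit constants `γₙ` produces a scattering
solution of the star-graph problem, whose scattering coefficients are given by the formulas
`t_{n,m} = 2tₘtₙ/((1+rₘ)(1+rₙ)ρ)` for `n ≠ m` and
`t_{m,m} = 2tₘ²/((1+rₘ)²ρ) − tₘ(1+conj rₘ)/(conj tₘ (1+rₘ))`. -/
theorem scattering_matrix_from_line_scattering
    (d : ℕ) (hd : 2 ≤ d) (k : ℝ) (hk : 0 < k)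
    (B : Fin d → ℝ → ℝ) (hBcont : ∀ n, Continuous (B n))
    (hBsupp : ∀ n, ∀ s : ℝ, s ∉ Icc (0 : ℝ) 1 → B n s = 0)
    (ψ : Fin d → ℝ → ℂ) (hψreg : ∀ n, ContDiff ℝ 2 (ψ n))
    (hψode : ∀ n, ∀ s : ℝ,
      -(deriv (deriv (ψ n)) s) + (B n s : ℂ) * ψ n s = (k : ℂ) ^ 2 * ψ n s)
    (r t : Fin d → ℂ)
    (hleft : ∀ n, ∀ s : ℝ, s ≤ 0 →
      ψ n s = Complex.exp (Complex.I * k * s) + r n * Complex.exp (-(Complex.I * k * s)))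
    (hright : ∀ n, ∀ s : ℝ, 1 ≤ s → ψ n s = t n * Complex.exp (Complex.I * k * s))
    (m : Fin d)
    (htne : ∀ n, t n ≠ 0) (hrne : ∀ n, 1 + r n ≠ 0)
    (hnorm : ∀ n, ‖r n‖ ^ 2 + ‖t n‖ ^ 2 = 1)
    (ρ : ℂ) (hρdef : ρ = ∑ j, (1 - r j) / (1 + r j)) (hρ : ρ ≠ 0) :
    IsScatteringSolution d B k m
      (fun n =>
        if n = m then
          2 * t m ^ 2 / ((1 + r m) ^ 2 * ρ)
            - t m * (1 + conj (r m)) / (conj (t m) * (1 + r m))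
        else
          2 * t m * t n / ((1 + r m) * (1 + r n) * ρ))
      (fun n s =>
        if n = m then
          (1 / conj (t m)) * conj (ψ m s)
            + (2 * t m / ((1 + r m) ^ 2 * ρ)
                - (1 + conj (r m)) / (conj (t m) * (1 + r m))) * ψ m s
        else
          (2 * t m / ((1 + r m) * (1 + r n) * ρ)) * ψ n s) := by
  have hψ0 : ∀ n, ψ n 0 = 1 + r n := fun n => by simpa using hleft n 0 le_rfl
  have hdψ : ∀ n, deriv (ψ n) 0 = Complex.I * k * (1 - r n) := fun n =>
    aux_left (ψ n) k (r n) ((hψreg n).differentiable (by norm_num)) (hleft n)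
  have htc : ∀ n, conj (t n) ≠ 0 := fun n => by simpa using htne n
  have hN : ∀ n, r n * conj (r n) + t n * conj (t n) = 1 := fun n => by
    rw [Complex.mul_conj, Complex.mul_conj, Complex.normSq_eq_norm_sq, Complex.normSq_eq_norm_sq]
    exact_mod_cast hnorm n
  have h1 := hrne m
  have h2 := htc m
  have hN' := hN m
  constructor
  · have key := aux_star d k B ψ hψreg hψode
      (fun n => if n = m then 1 / conj (t m) else 0)
      (fun n => 2 * t m / ((1 + r m) * (1 + r n) * ρ)
        - if n = m then (1 + conj (r m)) / (conj (t m) * (1 + r m)) else 0) ?_ ?_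
    · convert key using 3 with n s
      split_ifs with h
      · subst h; ring
      · ring
    · have : ∀ n, (if n = m then 1 / conj (t m) else 0) * conj (ψ n 0)
        + (2 * t m / ((1 + r m) * (1 + r n) * ρ)
        - if n = m then (1 + conj (r m)) / (conj (t m) * (1 + r m)) else 0) * ψ n 0
          = 2 * t m / ((1 + r m) * ρ) := by
        intro n
        have h3 := hrne n
        rw [hψ0]
        split_ifs with h
        · subst h
          simp only [map_add, map_one]
          field_simp
          ring
        · field_simp
          ring
      intro n n'
      exact (this n).trans (this n').symm
    · have : ∀ n, (if n = m then 1 / conj (t m) else 0) * conj (deriv (ψ n) 0)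
        + (2 * t m / ((1 + r m) * (1 + r n) * ρ)
        - if n = m then (1 + conj (r m)) / (conj (t m) * (1 + r m)) else 0) * deriv (ψ n) 0
          = Complex.I * k * (2 * t m / ((1 + r m) * ρ)) * ((1 - r n) / (1 + r n))
            - if n = m then Complex.I * k * (2 * t m / (1 + r m)) else 0 := by
        intro n
        have h3 := hrne n
        rw [hdψ]
        split_ifs with h
        · subst h
          simp only [map_sub, map_one, map_mul, Complex.conj_I, Complex.conj_ofReal]
          field_simp
          linear_combination (2 * k * ρ * (1 + r n)) * hN'
        · field_simp
          ring
      simp only [this]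
      rw [Finset.sum_sub_distrib, ← Finset.mul_sum, ← hρdef]
      simp
      field_simp
      ring
  · intro n s hs
    have hE : conj (Complex.exp (Complex.I * k * s)) = Complex.exp (-(Complex.I * k * s)) := by
      rw [← Complex.exp_conj]
      simp
    by_cases h : n = m
    · subst h
      simp only [if_true]
      rw [hright n s hs, map_mul, hE]
      field_simp
    · simp only [if_neg h]
      rw [hright n s hs]
      ring
end

section
/- Assume zero is not an eigenvalue of the Neumann problem on the truncated star graph: the only tuple (φ_1,…,φ_d) of twice continuously differentiable complex-valued functions on [0,2] with −φ_n'' + B_n φ_n = 0 on (0,2) for every n, φ_1(0) = ⋯ = φ_d(0), Σ_{n=1}^d φ_n'(0) = 0, and φ_n'(2) = 0 for every n, is the zero tuple. Then there exist C > 0 and k₀ > 0 such that for every k ∈ (0, k₀), every m ∈ {1,…,d}, and every scattering solution φ^{(m)} of the star-graph problem with wavenumber k whose coefficients satisfy |t_{n,m}| ≤ 1 for all n, one has |t_{n,m} + δ_{n,m}| ≤ C·k for all n ∈ {1,…,d}. In particular the scattering matrix tends to −I as k → 0, so that the limiting gluing condition at the vertex degenerates to the Dirichlet condition. -/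
open scoped BigOperators
open Set

lemma ss_linode {R : Type*} [NormedRing R] [NormOneClass R] [NormedSpace ℝ R] [CompleteSpace R] (A : ℝ → R)
    (hA : Continuous A) (M : ℝ) (hM0 : 0 ≤ M) (hM : ∀ t, ‖A t‖ ≤ M) :
    ∃ U : ℝ → R, U 0 = 1 ∧ ∀ t, HasDerivAt U (A t * U t) t := by
  let I : ℕ → ℝ → R := fun n => Nat.rec (fun _ => 1) (fun _ f t => ∫ s in (0:ℝ)..t, A s * f s) n
  have I0 : ∀ t, I 0 t = 1 := fun t => rfl
  have IS : ∀ n t, I (n+1) t = ∫ s in (0:ℝ)..t, A s * I n s := fun n t => rfl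
  have hc : ∀ n, Continuous (I n) := by
    intro n
    induction n with
    | zero => exact continuous_const
    | succ n ih =>
      exact intervalIntegral.continuous_primitive
        (fun a b => (hA.mul ih).intervalIntegrable a b) 0
  have hd : ∀ n t, HasDerivAt (I (n+1)) (A t * I n t) t := by
    intro n t
    exact intervalIntegral.integral_hasDerivAt_right ((hA.mul (hc n)).intervalIntegrable _ _)
      ((hA.mul (hc n)).stronglyMeasurableAtFilter _ _) (hA.mul (hc n)).continuousAt
  have hb : ∀ n t, ‖I n t‖ ≤ M ^ n * |t| ^ n / (n.factorial : ℝ) := by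
    intro n
    induction n with
    | zero => intro t; simp [I0]
    | succ n ih =>
      intro t
      rw [IS]
      calc _ ≤ ∫ s in Set.uIoc 0 t, ‖A s * I n s‖ :=
              intervalIntegral.norm_integral_le_integral_norm_uIoc
        _ ≤ ∫ s in Set.uIoc 0 t, (M ^ (n+1) / (n.factorial : ℝ)) * |s - 0| ^ n := by
              apply MeasureTheory.setIntegral_mono
              · exact ((hA.mul (hc n)).norm).integrableOn_uIoc
              · exact Continuous.integrableOn_uIoc (by fun_prop)
              · intro s
                calc ‖A s * I n s‖ ≤ ‖A s‖ * ‖I n s‖ := norm_mul_le _ _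
                  _ ≤ M * (M ^ n * |s| ^ n / (n.factorial : ℝ)) :=
                      mul_le_mul (hM s) (ih s) (norm_nonneg _) hM0
                  _ = _ := by simp; ring
        _ = _ := by
              rw [MeasureTheory.integral_const_mul, integral_pow_abs_sub_uIoc, Nat.factorial_succ]
              have : (n.factorial : ℝ) ≠ 0 := by positivity
              push_cast
              simp
              field_simp
  have hbT : ∀ T, 0 ≤ T → ∀ n t, |t| ≤ T → ‖I n t‖ ≤ (M * T) ^ n / (n.factorial : ℝ) := by
    intro T hT n t ht
    refine (hb n t).trans ?_
    rw [mul_pow]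
    gcongr
  have hsum : ∀ t, Summable (fun n => I n t) := fun t =>
    Summable.of_norm_bounded (Real.summable_pow_div_factorial (M * |t|))
      (fun n => hbT |t| (abs_nonneg _) n t le_rfl)
  have hS : ∀ t, HasDerivAt (fun z => ∑' n, I (n+1) z) (∑' n, A t * I n t) t := by
    intro t
    have hT : (0:ℝ) ≤ |t| + 1 := by positivity
    refine hasDerivAt_tsum_of_isPreconnected (g := fun n => I (n+1)) (g' := fun n t => A t * I n t) (t := Ioo (-(|t|+1)) (|t|+1)) (y₀ := t)
      (u := fun n => M * ((M * (|t|+1)) ^ n / (n.factorial : ℝ)))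
      ((Real.summable_pow_div_factorial _).mul_left M) isOpen_Ioo isPreconnected_Ioo
      (fun n y _ => hd n y) ?_ ?_ ?_ ?_
    · intro n y hy
      exact (norm_mul_le _ _).trans (mul_le_mul (hM y) (hbT _ hT n y (abs_lt.2 hy).le) (norm_nonneg _) hM0)
    · exact abs_lt.1 (lt_add_one _)
    · exact (summable_nat_add_iff 1).2 (hsum t)
    · exact abs_lt.1 (lt_add_one _)
  refine ⟨fun z => 1 + ∑' n, I (n+1) z, ?_, ?_⟩
  · simp [IS]
  · intro t
    have h := (hS t).const_add 1
    have e : A t * (1 + ∑' n, I (n+1) t) = ∑' n, A t * I n t := by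
      rw [(hsum t).tsum_mul_left, (hsum t).tsum_eq_zero_add, I0]
    rw [e]
    exact h

lemma ss_edge (φ : ℝ → ℂ) (q : ℝ → ℂ) (hq : Continuous q) (h : ContDiffOn ℝ 2 φ (Ici 0))
    (he : ∀ s ∈ Ioi (0:ℝ), deriv (deriv φ) s = q s * φ s) (s : ℝ) (hs : 0 ≤ s) :
    HasDerivWithinAt φ (derivWithin φ (Ici 0) s) (Ici 0) s ∧
    HasDerivWithinAt (derivWithin φ (Ici 0)) (q s * φ s) (Ici 0) s := by
  have hu : UniqueDiffOn ℝ (Ici (0:ℝ)) := uniqueDiffOn_Ici 0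
  have h1 : ContDiffOn ℝ 1 (derivWithin φ (Ici 0)) (Ici 0) := h.derivWithin hu (by norm_num)
  have h2 : ContinuousOn (derivWithin (derivWithin φ (Ici 0)) (Ici 0)) (Ici 0) :=
    h1.continuousOn_derivWithin hu (by norm_num)
  have e : EqOn (derivWithin (derivWithin φ (Ici 0)) (Ici 0)) (fun s => q s * φ s) (Ici 0) := by
    refine Set.EqOn.of_subset_closure (s := Ioi 0) ?_ h2 (hq.continuousOn.mul h.continuousOn)
      Ioi_subset_Ici_self (by rw [closure_Ioi])
    intro x hx
    have hx' : Ici (0:ℝ) ∈ nhds x := Ici_mem_nhds hx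
    show _ = q x * φ x
    rw [derivWithin_of_mem_nhds hx', ← he x hx]
    apply Filter.EventuallyEq.deriv_eq
    filter_upwards [Ioi_mem_nhds hx] with y hy
    exact derivWithin_of_mem_nhds (Ici_mem_nhds hy)
  refine ⟨((h.differentiableOn (by norm_num)) s hs).hasDerivWithinAt, ?_⟩
  have := ((h1.differentiableOn (by norm_num)) s hs).hasDerivWithinAt
  rw [e hs] at this
  exact this

noncomputable def ssA (d : ℕ) (B : Fin d → ℝ → ℝ) (t : ℝ) :
    (Fin d → ℂ × ℂ) →L[ℝ] (Fin d → ℂ × ℂ) :=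
  ContinuousLinearMap.pi (fun n =>
      (ContinuousLinearMap.inl ℝ ℂ ℂ).comp ((ContinuousLinearMap.snd ℝ ℂ ℂ).comp
        (ContinuousLinearMap.proj n)))
  + ∑ n, B n t • ((ContinuousLinearMap.single ℝ (fun _ : Fin d => ℂ × ℂ) n).comp
      ((ContinuousLinearMap.inr ℝ ℂ ℂ).comp ((ContinuousLinearMap.fst ℝ ℂ ℂ).comp
        (ContinuousLinearMap.proj n))))

lemma ssA_apply (d : ℕ) (B : Fin d → ℝ → ℝ) (t : ℝ) (x : Fin d → ℂ × ℂ) (n : Fin d) :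
    ssA d B t x n = ((x n).2, (B n t : ℂ) * (x n).1) := by
  simp only [ssA, add_apply, sum_apply, Pi.add_apply,
    Finset.sum_apply]
  rw [Finset.sum_eq_single n]
  · simp
  · intro b _ hb
    simp [hb.symm]
  · simp

lemma ssA_cont (d : ℕ) (B : Fin d → ℝ → ℝ) (hB : ∀ n, Continuous (B n)) :
    Continuous (ssA d B) := by
  unfold ssA
  fun_prop

lemma ssA_bdd (d : ℕ) (B : Fin d → ℝ → ℝ) (hB : ∀ n, Continuous (B n))
    (hBsupp : ∀ n, ∀ s : ℝ, s ∉ Icc (0 : ℝ) 1 → B n s = 0) :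
    ∃ M : ℝ, 0 < M ∧ ∀ t, ‖ssA d B t‖ ≤ M := by
  obtain ⟨M, hM⟩ := (isCompact_Icc (a := (0:ℝ)) (b := 1)).exists_bound_of_continuousOn
    (ssA_cont d B hB).continuousOn
  refine ⟨max M ‖ssA d B 2‖ + 1, by positivity, fun t => ?_⟩
  by_cases ht : t ∈ Icc (0:ℝ) 1
  · linarith [hM t ht, le_max_left M ‖ssA d B 2‖]
  · have : ssA d B t = ssA d B 2 := by
      unfold ssA
      congr 1
      refine Finset.sum_congr rfl fun n _ => ?_
      rw [hBsupp n t ht, hBsupp n 2 (by norm_num)]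
    rw [this]
    linarith [le_max_right M ‖ssA d B 2‖]

/-- injectivity estimate -/
lemma ss_inj (d : ℕ)
    (B : Fin d → ℝ → ℝ) (hBcont : ∀ n, Continuous (B n))
    (hNeumann : ∀ φ : Fin d → ℝ → ℂ,
      (∀ n, ContDiffOn ℝ 2 (φ n) (Icc 0 2)) →
      (∀ n, ∀ s ∈ Ioo (0 : ℝ) 2,
        -(deriv (deriv (φ n)) s) + (B n s : ℂ) * φ n s = 0) →
      (∀ n n' : Fin d, φ n 0 = φ n' 0) →
      (∑ n, derivWithin (φ n) (Icc (0 : ℝ) 2) 0 = 0) →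
      (∀ n, derivWithin (φ n) (Icc (0 : ℝ) 2) 2 = 0) →
      ∀ n, ∀ s ∈ Icc (0 : ℝ) 2, φ n s = 0)
    (U : ℝ → (Fin d → ℂ × ℂ) →L[ℝ] (Fin d → ℂ × ℂ)) (hU0 : U 0 = 1)
    (hU : ∀ t x, HasDerivAt (fun t => U t x) (ssA d B t (U t x)) t) :
    ∃ C : ℝ, 0 < C ∧ ∀ x : Fin d → ℂ × ℂ, (∀ n n', (x n).1 = (x n').1) → ∑ n, (x n).2 = 0 →
      ‖x‖ ≤ C * ‖fun n => (U 2 x n).2‖ := by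
  let V : Submodule ℝ (Fin d → ℂ × ℂ) :=
    { carrier := {x | (∀ n n', (x n).1 = (x n').1) ∧ ∑ n, (x n).2 = 0}
      add_mem' := by
        rintro x y ⟨h1, h2⟩ ⟨h3, h4⟩
        refine ⟨fun n n' => ?_, ?_⟩
        · simp [h1 n n', h3 n n']
        · simp [Finset.sum_add_distrib, h2, h4]
      zero_mem' := by simp
      smul_mem' := by
        rintro c x ⟨h1, h2⟩
        refine ⟨fun n n' => ?_, ?_⟩
        · simp [h1 n n']
        · simp [← Finset.mul_sum, h2] }
  let T : V →ₗ[ℝ] (Fin d → ℂ) :=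
    (LinearMap.pi fun n => (LinearMap.snd ℝ ℂ ℂ).comp ((LinearMap.proj n).comp
      (U 2 : (Fin d → ℂ × ℂ) →ₗ[ℝ] (Fin d → ℂ × ℂ)))).comp V.subtype
  have hT : ∀ x : V, T x = fun n => (U 2 x n).2 := fun x => rfl
  have hker : LinearMap.ker T = ⊥ := by
    rw [LinearMap.ker_eq_bot']
    rintro ⟨x, hx1, hx2⟩ hx
    rw [hT] at hx
    have hx' : ∀ n, (U 2 x n).2 = 0 := fun n => congrFun hx n
    have D1 : ∀ n t, HasDerivAt (fun t => (U t x n).1) ((U t x n).2) t := by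
      intro n t
      have := (hasDerivAt_pi.1 (hU t x) n)
      rw [ssA_apply] at this
      exact (ContinuousLinearMap.fst ℝ ℂ ℂ).hasFDerivAt.comp_hasDerivAt t this
    have D2 : ∀ n t, HasDerivAt (fun t => (U t x n).2) ((B n t : ℂ) * (U t x n).1) t := by
      intro n t
      have := (hasDerivAt_pi.1 (hU t x) n)
      rw [ssA_apply] at this
      exact (ContinuousLinearMap.snd ℝ ℂ ℂ).hasFDerivAt.comp_hasDerivAt t this
    have d1 : ∀ n, deriv (fun t => (U t x n).1) = fun t => (U t x n).2 := fun n =>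
      funext fun t => (D1 n t).deriv
    have d2 : ∀ n, deriv (fun t => (U t x n).2) = fun t => (B n t : ℂ) * (U t x n).1 := fun n =>
      funext fun t => (D2 n t).deriv
    have hud : UniqueDiffOn ℝ (Icc (0:ℝ) 2) := uniqueDiffOn_Icc (by norm_num)
    have dw : ∀ n, ∀ t ∈ Icc (0:ℝ) 2, derivWithin (fun t => (U t x n).1) (Icc 0 2) t = (U t x n).2 :=
      fun n t ht => (D1 n t).hasDerivWithinAt.derivWithin (hud t ht)
    have hz := hNeumann (fun n t => (U t x n).1) ?_ ?_ ?_ ?_ ?_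
    · have hx0 : x = 0 := by
        funext n
        have e1 : (x n).1 = 0 := by simpa [hU0] using hz n 0 (by norm_num)
        have e2 : (x n).2 = 0 := by
          have := dw n 0 (by norm_num)
          rw [derivWithin_congr (f := fun _ => (0:ℂ)) (fun t ht => hz n t ht) (hz n 0 (by norm_num))] at this
          simpa [hU0] using this.symm
        exact Prod.ext e1 e2
      exact Subtype.ext hx0
    · intro n
      apply ContDiff.contDiffOn
      have hc1 : Continuous fun t => (U t x n).1 :=
        continuous_iff_continuousAt.2 fun t => (D1 n t).continuousAt
      have : ContDiff ℝ 1 (fun t => (U t x n).2) := by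
        rw [contDiff_one_iff_deriv, d2]
        exact ⟨fun t => (D2 n t).differentiableAt,
          (Complex.continuous_ofReal.comp (hBcont n)).mul hc1⟩
      rw [show (2 : WithTop ℕ∞) = 1 + 1 by norm_num, contDiff_succ_iff_deriv, d1]
      exact ⟨fun t => (D1 n t).differentiableAt, by simp, this⟩
    · intro n s _
      simp [d1, d2]
    · intro n n'
      simpa [hU0] using hx1 n n'
    · rw [← hx2]
      refine Finset.sum_congr rfl fun n _ => ?_
      rw [dw n 0 (by norm_num)]
      simp [hU0]
    · intro n
      rw [dw n 2 (by norm_num)]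
      exact hx' n
  obtain ⟨K, hK, hK'⟩ := T.exists_antilipschitzWith hker
  refine ⟨K, by exact_mod_cast hK, fun x h1 h2 => ?_⟩
  have := hK'.le_mul_dist ⟨x, h1, h2⟩ 0
  rw [map_zero, dist_zero_right, dist_zero_right, hT] at this
  exact this

lemma ss_exp (k : ℝ) (hk : 0 < k) : ‖Complex.exp (Complex.I * k * 2) - 1‖ ≤ 2 * k ∧
    ‖Complex.exp (-(Complex.I * k * 2)) - 1‖ ≤ 2 * k := by
  have h : ∀ r : ℝ, ‖Complex.exp (Complex.I * r) - 1‖ ≤ |r| := fun r => by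
    simpa using Real.norm_exp_I_mul_ofReal_sub_one_le (x := r)
  constructor
  · have := h (k * 2)
    rw [abs_of_pos (by positivity)] at this
    push_cast at this
    rw [← mul_assoc] at this
    linarith
  · have := h (-(k * 2))
    rw [abs_neg, abs_of_pos (by positivity)] at this
    push_cast at this
    rw [mul_neg, ← mul_assoc] at this
    linarith

lemma ss_end (k : ℝ) (hk : 0 < k) (a t : ℂ) (ha : ‖a‖ ≤ 1) (ht : ‖t‖ ≤ 1) (φ : ℝ → ℂ)
    (h : ∀ s : ℝ, 1 ≤ s → φ s = a * Complex.exp (-(Complex.I * k * s))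
            + t * Complex.exp (Complex.I * k * s)) :
    ‖derivWithin φ (Ici 0) 2‖ ≤ 2 * k ∧ ‖t + a‖ ≤ ‖φ 2‖ + 4 * k := by
  obtain ⟨e1, e2⟩ := ss_exp k hk
  have n1 : ‖Complex.exp (Complex.I * k * 2)‖ = 1 := by
    rw [Complex.norm_exp]; simp
  have n2 : ‖Complex.exp (-(Complex.I * k * 2))‖ = 1 := by
    rw [Complex.norm_exp]; simp
  constructor
  · have hd : HasDerivAt φ (a * (Complex.exp (-(Complex.I * k * (2:ℝ))) * (-(Complex.I * k * 1)))
        + t * (Complex.exp (Complex.I * k * (2:ℝ)) * (Complex.I * k * 1))) 2 := by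
      have h0 : HasDerivAt (fun s : ℝ => Complex.I * k * (s:ℂ)) (Complex.I * k * 1) 2 :=
        (Complex.ofRealCLM.hasDerivAt (x := (2:ℝ))).const_mul (Complex.I * k)
      have h1 := (h0.neg.cexp.const_mul a).add (h0.cexp.const_mul t)
      refine h1.congr_of_eventuallyEq ?_
      filter_upwards [Ici_mem_nhds (show (1:ℝ) < 2 by norm_num)] with s hs
      exact h s hs
    rw [derivWithin_of_mem_nhds (Ici_mem_nhds (by norm_num)), hd.deriv]
    refine (norm_add_le _ _).trans ?_
    simp only [norm_mul, norm_neg, Complex.ofReal_ofNat, n1, n2, Complex.norm_I, norm_one,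
      Complex.norm_real, Real.norm_eq_abs, abs_of_pos hk]
    nlinarith
  · have h2 := h 2 (by norm_num)
    push_cast at h2
    have : t + a = φ 2 - a * (Complex.exp (-(Complex.I * k * 2)) - 1)
        - t * (Complex.exp (Complex.I * k * 2) - 1) := by rw [h2]; ring
    rw [this]
    refine (norm_sub_le _ _).trans ?_
    refine (add_le_add (norm_sub_le _ _) le_rfl).trans ?_
    rw [norm_mul, norm_mul]
    have i1 := mul_le_mul ha e2 (norm_nonneg _) zero_le_one
    have i2 := mul_le_mul ht e1 (norm_nonneg _) zero_le_one
    linarith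

/-- If zero is not an eigenvalue of the Neumann problem on the truncated star graph
`[0,2]`, then near the bottom of the spectrum the scattering matrix tends to `−I`:
there are `C > 0`, `k₀ > 0` such that for all `0 < k < k₀` and every scattering solution
with coefficients `|t_{n,m}| ≤ 1`, one has `|t_{n,m} + δ_{n,m}| ≤ C·k`.  In particular the
limiting gluing condition degenerates to the Dirichlet condition. -/
theorem scattering_matrix_dirichlet_limit
    (d : ℕ) (hd : 2 ≤ d)
    (B : Fin d → ℝ → ℝ) (hBcont : ∀ n, Continuous (B n))
    (hBsupp : ∀ n, ∀ s : ℝ, s ∉ Icc (0 : ℝ) 1 → B n s = 0)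
    (hNeumann : ∀ φ : Fin d → ℝ → ℂ,
      (∀ n, ContDiffOn ℝ 2 (φ n) (Icc 0 2)) →
      (∀ n, ∀ s ∈ Ioo (0 : ℝ) 2,
        -(deriv (deriv (φ n)) s) + (B n s : ℂ) * φ n s = 0) →
      (∀ n n' : Fin d, φ n 0 = φ n' 0) →
      (∑ n, derivWithin (φ n) (Icc (0 : ℝ) 2) 0 = 0) →
      (∀ n, derivWithin (φ n) (Icc (0 : ℝ) 2) 2 = 0) →
      ∀ n, ∀ s ∈ Icc (0 : ℝ) 2, φ n s = 0) :
    ∃ C > (0 : ℝ), ∃ k₀ > (0 : ℝ), ∀ k : ℝ, 0 < k → k < k₀ →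
      ∀ (m : Fin d) (t : Fin d → ℂ) (φ : Fin d → ℝ → ℂ),
        IsScatteringSolution d B k m t φ →
        (∀ n, ‖t n‖ ≤ 1) →
        ∀ n, ‖t n + (if n = m then 1 else 0)‖ ≤ C * k := by
  have : Nonempty (Fin d) := ⟨⟨0, by omega⟩⟩
  obtain ⟨M, hM0, hM⟩ := ssA_bdd d B hBcont hBsupp
  obtain ⟨U, hU0, hU⟩ := ss_linode (ssA d B) (ssA_cont d B hBcont) M hM0.le hM
  have hUx : ∀ t x, HasDerivAt (fun t => U t x) (ssA d B t (U t x)) t := fun t x =>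
    (ContinuousLinearMap.apply ℝ (Fin d → ℂ × ℂ) x).hasFDerivAt.comp_hasDerivAt t (hU t)
  obtain ⟨C, hC, hinj⟩ := ss_inj d B hBcont hNeumann U hU0 hUx
  obtain ⟨G, hG⟩ : ∃ G, G = Real.exp ((M + 1) * 2) := ⟨_, rfl⟩
  have hGpos : 0 < G := hG ▸ Real.exp_pos _
  obtain ⟨H, hH⟩ : ∃ H, H = G * (Real.exp (M * 2) / M) := ⟨_, rfl⟩
  have hHpos : 0 < H := by rw [hH]; have := Real.exp_pos (M * 2); positivity
  refine ⟨4 * C * G + 4, by positivity, min 1 (1 / (2 * C * H)), by positivity, ?_⟩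
  intro k hk hkk m t φ ⟨⟨hφ, heq, hcont, hkir⟩, hsc⟩ ht n
  have hk1 : k < 1 := lt_of_lt_of_le hkk (min_le_left _ _)
  have hk2 : k * (2 * C * H) < 1 := by
    rw [← lt_div_iff₀ (by positivity)]
    exact lt_of_lt_of_le hkk (min_le_right _ _)
  have hend := fun n => ss_end k hk (if n = m then 1 else 0) (t n) (by split_ifs <;> simp) (ht n)
    (φ n) (hsc n)
  let y : ℝ → Fin d → ℂ × ℂ := fun s n => (φ n s, derivWithin (φ n) (Ici 0) s)
  let E : ℝ → Fin d → ℂ × ℂ := fun s n => (0, -(k:ℂ)^2 * φ n s)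
  have hy : ∀ s, 0 ≤ s → HasDerivWithinAt y (ssA d B s (y s) + E s) (Ici 0) s := by
    intro s hs
    rw [hasDerivWithinAt_pi]
    intro n
    obtain ⟨a1, a2⟩ := ss_edge (φ n) (fun s => (B n s : ℂ) - (k:ℂ)^2)
      ((Complex.continuous_ofReal.comp (hBcont n)).sub continuous_const) (hφ n)
      (fun s hs => by linear_combination -(heq n s hs)) s hs
    have := a1.prodMk a2
    have e : (ssA d B s (y s) + E s) n =
        (derivWithin (φ n) (Ici 0) s, ((B n s : ℂ) - (k:ℂ)^2) * φ n s) := by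
      rw [Pi.add_apply, ssA_apply]
      refine Prod.ext ?_ ?_
      · simp [y, E]
      · simp only [y, E, Prod.snd_add]
        ring
    rw [e]
    exact this
  have hE : ∀ s, ‖E s‖ ≤ k ^ 2 * ‖y s‖ := by
    intro s
    rw [pi_norm_le_iff_of_nonneg (by positivity)]
    intro n
    have h1 : ‖φ n s‖ ≤ ‖y s‖ := (norm_fst_le (y s n)).trans (norm_le_pi_norm (y s) n)
    have h2 : ‖E s n‖ = k ^ 2 * ‖φ n s‖ := by
      simp [E, Prod.norm_def]
      positivity
    rw [h2]
    gcongr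
  have hyc : ContinuousOn y (Icc 0 2) := fun s hs =>
    ((hy s hs.1).continuousWithinAt).mono Icc_subset_Ici_self
  have hyr : ∀ s ∈ Ico (0:ℝ) 2, HasDerivWithinAt y (ssA d B s (y s) + E s) (Ici s) s :=
    fun s hs => (hy s hs.1).mono (Ici_subset_Ici.2 hs.1)
  have hAy : ∀ s x, ‖ssA d B s x‖ ≤ M * ‖x‖ := fun s x =>
    (ssA d B s).le_of_opNorm_le (hM s) x
  have hkk1 : k ^ 2 ≤ 1 := by nlinarith
  have hyb : ∀ s ∈ Icc (0:ℝ) 2, ‖y s‖ ≤ ‖y 0‖ * G := by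
    intro s hs
    have := norm_le_gronwallBound_of_norm_deriv_right_le (K := M + 1) (ε := 0) (δ := ‖y 0‖)
      hyc hyr le_rfl (fun s hs => by
        refine (norm_add_le _ _).trans ?_
        have := mul_le_mul_of_nonneg_right hkk1 (norm_nonneg (y s))
        linarith [hAy s (y s), hE s]) s hs
    rw [gronwallBound_ε0] at this
    refine this.trans ?_
    rw [hG]
    gcongr
    linarith [hs.2]
  have hD : ‖y 2 - U 2 (y 0)‖ ≤ k ^ 2 * ‖y 0‖ * H := by
    have := norm_le_gronwallBound_of_norm_deriv_right_le (K := M) (ε := k ^ 2 * (‖y 0‖ * G))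
      (δ := 0) (f := fun s => y s - U s (y 0))
      (f' := fun s => (ssA d B s (y s) + E s) - ssA d B s (U s (y 0))) (a := 0) (b := 2)
      (hyc.sub fun s hs => (hUx s (y 0)).continuousAt.continuousWithinAt)
      (fun s hs => (hyr s hs).sub (hUx s (y 0)).hasDerivWithinAt) (by simp [hU0])
      (fun s hs => by
        have e : (ssA d B s (y s) + E s) - ssA d B s (U s (y 0)) =
          ssA d B s (y s - U s (y 0)) + E s := by rw [map_sub]; abel
        rw [e]
        refine (norm_add_le _ _).trans (add_le_add (hAy _ _) ((hE s).trans ?_))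
        gcongr
        exact hyb s (Ico_subset_Icc_self hs)) 2 (by norm_num)
    rw [gronwallBound_of_K_ne_0 hM0.ne'] at this
    refine this.trans ?_
    simp only [zero_mul, zero_add, sub_zero]
    rw [hH]
    have e : k ^ 2 * ‖y 0‖ * (G * (Real.exp (M * 2) / M)) =
      k ^ 2 * (‖y 0‖ * G) / M * Real.exp (M * 2) := by ring
    rw [e]
    gcongr
    linarith
  have hT : ‖fun n => (U 2 (y 0) n).2‖ ≤ 2 * k + k ^ 2 * ‖y 0‖ * H := by
    rw [pi_norm_le_iff_of_nonneg (by positivity)]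
    intro n
    have h1 := (norm_snd_le ((y 2 - U 2 (y 0)) n)).trans
      ((norm_le_pi_norm (y 2 - U 2 (y 0)) n).trans hD)
    have h2 : (U 2 (y 0) n).2 = derivWithin (φ n) (Ici 0) 2 - ((y 2 - U 2 (y 0)) n).2 := by
      simp [y]
    rw [h2]
    exact (norm_sub_le _ _).trans (add_le_add (hend n).1 h1)
  have hy0 : ‖y 0‖ ≤ C * (2 * k + k ^ 2 * ‖y 0‖ * H) :=
    (hinj (y 0) (fun n n' => hcont n n') hkir).trans (mul_le_mul_of_nonneg_left hT hC.le)
  have hsmall : C * H * k ^ 2 ≤ 1 / 2 := by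
    have : 0 < C * H := by positivity
    nlinarith
  have hy0' : ‖y 0‖ ≤ 4 * C * k := by
    have := mul_le_mul_of_nonneg_right hsmall (norm_nonneg (y 0))
    nlinarith
  have hfin : ‖φ n 2‖ ≤ 4 * C * k * G :=
    ((norm_fst_le (y 2 n)).trans (norm_le_pi_norm (y 2) n)).trans
      ((hyb 2 (by norm_num)).trans (mul_le_mul_of_nonneg_right hy0' hGpos.le))
  have := (hend n).2
  linarith
end

section
/- Assume zero is not an eigenvalue of the Neumann problem on the truncated star graph: the only tuple (φ_1,…,φ_d) of twice continuously differentiable complex-valued functions on [0,2] with −φ_n'' + B_n φ_n = 0 on (0,2) for every n, φ_1(0) = ⋯ = φ_d(0), Σ_{n=1}^d φ_n'(0) = 0, and φ_n'(2) = 0 for every n, is the zero tuple. Then there exist C > 0 and k₀ > 0 such that for every k ∈ (0, k₀), every m ∈ {1,…,d}, and every scattering solution φ^{(m)} of the star-graph problem with wavenumber k whose coefficients satisfy |t_{n,m}| ≤ 1 for all n, one has sup_{n ∈ {1,…,d}} sup_{s ∈ [0,2]} |φ^{(m)}_n(s)| ≤ C·k. In particular the values of the scattering solutions at the vertex tend to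 zero as k → 0. -/
open scoped BigOperators
open Set

open Filter Topology in
lemma limit_traj {E : Type*} [NormedAddCommGroup E] [NormedSpace ℝ E] [CompleteSpace E]
    (f : ℝ → E → E) (hf : Continuous (fun p : ℝ × E => f p.1 p.2)) (K : NNReal) (hK1 : 1 ≤ K)
    (hK : ∀ t, LipschitzWith K (f t)) (Z D : ℕ → ℝ → E) (η : ℕ → ℝ)
    (hη : Tendsto η atTop (𝓝 0)) (M : ℝ)
    (hZ : ∀ j, ∀ t ∈ Icc (0:ℝ) 2, HasDerivWithinAt (Z j) (D j t) (Icc 0 2) t)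
    (hD : ∀ j, ContinuousOn (D j) (Icc 0 2))
    (hM : ∀ j, ∀ t ∈ Icc (0:ℝ) 2, ‖D j t‖ ≤ M)
    (happ : ∀ j, ∀ t ∈ Icc (0:ℝ) 2, ‖D j t - f t (Z j t)‖ ≤ η j)
    (c : E) (h0 : Tendsto (fun j => Z j 0) atTop (𝓝 c)) :
    ∃ Y : ℝ → E, (∀ t ∈ Icc (0:ℝ) 2, HasDerivWithinAt Y (f t (Y t)) (Icc 0 2) t) ∧ Y 0 = c ∧
      ∀ t ∈ Icc (0:ℝ) 2, Tendsto (fun j => Z j t) atTop (𝓝 (Y t)) := by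
  have hZc : ∀ j, ContinuousOn (Z j) (Icc 0 2) := fun j t ht => (hZ j t ht).continuousWithinAt
  have hZr : ∀ j, ∀ t ∈ Ico (0:ℝ) 2, HasDerivWithinAt (Z j) (D j t) (Ici t) t := by
    intro j t ht
    exact (hZ j t (Ico_subset_Icc_self ht)).mono_of_mem_nhdsWithin
      (mem_of_superset (Icc_mem_nhdsGE ht.2) (Icc_subset_Icc_left ht.1))
  have hη0 : ∀ j, 0 ≤ η j := fun j => (norm_nonneg _).trans (happ j 0 (by simp))
  have hdist : ∀ i j, ∀ t ∈ Icc (0:ℝ) 2, dist (Z i t) (Z j t) ≤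
      (dist (Z i 0) (Z j 0) + (η i + η j)) * Real.exp (K * 2) := by
    intro i j t ht
    have := dist_le_of_approx_trajectories_ODE hK (hZc i) (hZr i)
      (fun t ht => by rw [dist_eq_norm]; exact happ i t (Ico_subset_Icc_self ht)) (hZc j) (hZr j)
      (fun t ht => by rw [dist_eq_norm]; exact happ j t (Ico_subset_Icc_self ht)) le_rfl t ht
    refine this.trans ?_
    have hK1' : (1:ℝ) ≤ K := by exact_mod_cast hK1
    rw [gronwallBound_of_K_ne_0 (by positivity), sub_zero]
    have h1 : Real.exp (K * t) ≤ Real.exp (K * 2) := by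
      apply Real.exp_le_exp.2; have := ht.2; gcongr
    have h2 : (η i + η j) / K ≤ η i + η j := div_le_self (add_nonneg (hη0 i) (hη0 j)) hK1'
    have h3 : 0 ≤ Real.exp (K * t) - 1 := by
      have : 0 ≤ K * t := mul_nonneg K.2 ht.1
      linarith [Real.one_le_exp this]
    rw [add_mul]
    exact add_le_add (mul_le_mul_of_nonneg_left h1 dist_nonneg)
      (mul_le_mul h2 (by linarith) h3 (add_nonneg (hη0 i) (hη0 j)))
  have hUC : UniformCauchySeqOn Z atTop (Icc 0 2) := by
    rw [Metric.uniformCauchySeqOn_iff]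
    intro ε hε
    have hc := Metric.cauchySeq_iff.1 h0.cauchySeq
    set X := Real.exp (K * 2) with hX
    have hXp : 0 < X := Real.exp_pos _
    obtain ⟨N1, hN1⟩ := hc (ε / (3 * X)) (by positivity)
    obtain ⟨N2, hN2⟩ := eventually_atTop.1 (hη.eventually (gt_mem_nhds (show 0 < ε / (3 * X) by positivity)))
    refine ⟨max N1 N2, fun m hm n hn t ht => (hdist m n t ht).trans_lt ?_⟩
    have e1 := hN1 m ((le_max_left _ _).trans hm) n ((le_max_left _ _).trans hn)
    have e2 := hN2 m ((le_max_right _ _).trans hm)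
    have e3 := hN2 n ((le_max_right _ _).trans hn)
    calc _ < (ε / (3 * X) + (ε / (3 * X) + ε / (3 * X))) * X := by gcongr
      _ = ε := by field_simp; ring
  have hlim : ∀ t : ℝ, ∃ y, t ∈ Icc (0:ℝ) 2 → Tendsto (fun j => Z j t) atTop (𝓝 y) := by
    intro t
    by_cases ht : t ∈ Icc (0:ℝ) 2
    · obtain ⟨y, hy⟩ := cauchySeq_tendsto_of_complete (hUC.cauchySeq ht)
      exact ⟨y, fun _ => hy⟩
    · exact ⟨0, fun h => absurd h ht⟩
  choose L hL using hlim
  have hLc : ContinuousOn L (Icc 0 2) :=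
    (hUC.tendstoUniformlyOn_of_tendsto hL).continuousOn (Frequently.of_forall hZc)
  let g : ℝ → E := fun s => f s (L (projIcc (0:ℝ) 2 (by norm_num) s))
  have hg : Continuous g := by
    have : Continuous fun s : ℝ => L (projIcc (0:ℝ) 2 (by norm_num) s) :=
      hLc.comp_continuous (by fun_prop) (fun s => (projIcc (0:ℝ) 2 _ s).2)
    exact hf.comp (continuous_id.prodMk this)
  have hgL : ∀ s ∈ Icc (0:ℝ) 2, g s = f s (L s) := by
    intro s hs
    simp only [g]; rw [projIcc_of_mem _ hs]
  have hDlim : ∀ s ∈ Icc (0:ℝ) 2, Tendsto (fun j => D j s) atTop (𝓝 (g s)) := by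
    intro s hs
    rw [hgL s hs]
    have h1 : Tendsto (fun j => f s (Z j s)) atTop (𝓝 (f s (L s))) :=
      ((hK s).continuous.tendsto _).comp (hL s hs)
    have h2 : Tendsto (fun j => D j s - f s (Z j s)) atTop (𝓝 0) :=
      squeeze_zero_norm (fun j => happ j s hs) hη
    simpa using h2.add h1
  have hint : ∀ t ∈ Icc (0:ℝ) 2, L t = c + ∫ s in (0:ℝ)..t, g s := by
    intro t ht
    have hsub : Icc 0 t ⊆ Icc (0:ℝ) 2 := Icc_subset_Icc_right ht.2
    have hI : ∀ j, IntervalIntegrable (D j) MeasureTheory.volume 0 t := fun j =>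
      ContinuousOn.intervalIntegrable (by rw [uIcc_of_le ht.1]; exact (hD j).mono hsub)
    have hF : ∀ j, ∫ s in (0:ℝ)..t, D j s = Z j t - Z j 0 := by
      intro j
      refine intervalIntegral.integral_eq_sub_of_hasDeriv_right_of_le ht.1 ((hZc j).mono hsub)
        (fun x hx => (hZr j x ⟨hx.1.le, hx.2.trans_le ht.2⟩).mono Ioi_subset_Ici_self) (hI j)
    have h1 : Tendsto (fun j => ∫ s in (0:ℝ)..t, D j s) atTop (𝓝 (∫ s in (0:ℝ)..t, g s)) := by
      refine intervalIntegral.tendsto_integral_filter_of_dominated_convergence (fun _ => M)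
        (Eventually.of_forall fun j => ?_) (Eventually.of_forall fun j => ?_) (by simp) ?_
      · exact (intervalIntegrable_iff.1 (hI j)).aestronglyMeasurable
      · refine Eventually.of_forall fun x hx => hM j x ?_
        rw [uIoc_of_le ht.1] at hx
        exact hsub (Ioc_subset_Icc_self hx)
      · refine Eventually.of_forall fun x hx => hDlim x ?_
        rw [uIoc_of_le ht.1] at hx
        exact hsub (Ioc_subset_Icc_self hx)
    have h2 : Tendsto (fun j => ∫ s in (0:ℝ)..t, D j s) atTop (𝓝 (L t - c)) := by
      simp only [hF]; exact (hL t ht).sub h0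
    rw [tendsto_nhds_unique h1 h2]; simp
  refine ⟨fun t => c + ∫ s in (0:ℝ)..t, g s, ?_, by simp, fun t ht => ?_⟩
  · intro t ht
    have : HasDerivAt (fun t => c + ∫ s in (0:ℝ)..t, g s) (g t) t :=
      (hg.integral_hasStrictDerivAt 0 t).hasDerivAt.const_add c
    beta_reduce
    rw [← hint t ht, ← hgL t ht]
    exact this.hasDerivWithinAt
  · beta_reduce
    rw [← hint t ht]; exact hL t ht

open Filter Topology in
lemma core_bound {E F : Type*} [NormedAddCommGroup E] [NormedSpace ℝ E] [FiniteDimensional ℝ E]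
    [NormedAddCommGroup F] [NormedSpace ℝ F]
    (f : ℝ → E → E) (hf : Continuous (fun p : ℝ × E => f p.1 p.2)) (K : NNReal) (hK1 : 1 ≤ K)
    (hK : ∀ t, LipschitzWith K (f t)) (hhom : ∀ t (a : ℝ) x, f t (a • x) = a • f t x)
    (P : E →L[ℝ] E) (L : E →L[ℝ] F) (W : Submodule ℝ E)
    (hinj : ∀ Y : ℝ → E, (∀ t ∈ Icc (0:ℝ) 2, HasDerivWithinAt Y (f t (Y t)) (Icc 0 2) t) →
      Y 0 ∈ W → L (Y 2) = 0 → Y 0 = 0) :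
    ∃ C > (0:ℝ), ∃ k₀ > (0:ℝ), ∀ k : ℝ, 0 < k → k < k₀ → ∀ Y : ℝ → E,
      (∀ t ∈ Icc (0:ℝ) 2, HasDerivWithinAt Y (f t (Y t) - k ^ 2 • P (Y t)) (Icc 0 2) t) →
      Y 0 ∈ W → ‖L (Y 2)‖ ≤ 2 * k → ∀ t ∈ Icc (0:ℝ) 2, ‖Y t‖ ≤ C * k := by
  have : CompleteSpace E := FiniteDimensional.complete ℝ E
  have : ProperSpace E := FiniteDimensional.proper ℝ E
  have hf0 : ∀ t, f t 0 = 0 := fun t => by simpa using hhom t 0 0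
  have hfb : ∀ t x, ‖f t x‖ ≤ K * ‖x‖ := fun t x => by
    simpa [hf0] using (hK t).dist_le_mul x 0
  set R : ℝ := K + ‖P‖ with hR
  have hRp : 0 ≤ R := by positivity
  have hder : ∀ k : ℝ, 0 < k → k ≤ 1 → ∀ t y, ‖f t y - k ^ 2 • P y‖ ≤ R * ‖y‖ := by
    intro k hk hk1 t y
    have h1 : ‖k ^ 2 • P y‖ ≤ ‖P‖ * ‖y‖ := by
      rw [norm_smul, Real.norm_of_nonneg (by positivity)]
      have : k ^ 2 ≤ 1 := pow_le_one₀ hk.le hk1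
      calc _ ≤ 1 * ‖P y‖ := by gcongr
        _ ≤ _ := by rw [one_mul]; exact P.le_opNorm y
    calc _ ≤ ‖f t y‖ + ‖k ^ 2 • P y‖ := norm_sub_le _ _
      _ ≤ K * ‖y‖ + ‖P‖ * ‖y‖ := add_le_add (hfb t y) h1
      _ = _ := by rw [hR]; ring
  have hgr : ∀ k : ℝ, 0 < k → k ≤ 1 → ∀ Y : ℝ → E,
      (∀ t ∈ Icc (0:ℝ) 2, HasDerivWithinAt Y (f t (Y t) - k ^ 2 • P (Y t)) (Icc 0 2) t) →
      ∀ t ∈ Icc (0:ℝ) 2, ‖Y t‖ ≤ ‖Y 0‖ * Real.exp (R * 2) := by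
    intro k hk hk1 Y hY t ht
    have := norm_le_gronwallBound_of_norm_deriv_right_le (f := Y) (δ := ‖Y 0‖) (K := R) (ε := 0)
      (fun t ht => (hY t ht).continuousWithinAt) (fun t ht =>
        (hY t (Ico_subset_Icc_self ht)).mono_of_mem_nhdsWithin
      (mem_of_superset (Icc_mem_nhdsGE ht.2) (Icc_subset_Icc_left ht.1))) le_rfl
      (fun t ht => by simpa using hder k hk hk1 t (Y t)) t ht
    rw [gronwallBound_ε0, sub_zero] at this
    refine this.trans ?_
    have := ht.2
    gcongr
  suffices H : ∃ C > (0:ℝ), ∃ k₀ > (0:ℝ), ∀ k : ℝ, 0 < k → k < k₀ → ∀ Y : ℝ → E,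
      (∀ t ∈ Icc (0:ℝ) 2, HasDerivWithinAt Y (f t (Y t) - k ^ 2 • P (Y t)) (Icc 0 2) t) →
      Y 0 ∈ W → ‖L (Y 2)‖ ≤ 2 * k → ‖Y 0‖ ≤ C * k by
    obtain ⟨C, hC, k₀, hk₀, H⟩ := H
    refine ⟨C * Real.exp (R * 2), by positivity, min k₀ 1, by positivity, ?_⟩
    intro k hk hkk Y hY hW hL t ht
    refine (hgr k hk (hkk.le.trans (min_le_right _ _)) Y hY t ht).trans ?_
    have := H k hk (hkk.trans_le (min_le_left _ _)) Y hY hW hL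
    calc _ ≤ C * k * Real.exp (R * 2) := by gcongr
      _ = _ := by ring
  by_contra hcon
  push Not at hcon
  have hseq : ∀ j : ℕ, ∃ k : ℝ, 0 < k ∧ k < 1 / ((j:ℝ) + 1) ∧ ∃ Y : ℝ → E,
      (∀ t ∈ Icc (0:ℝ) 2, HasDerivWithinAt Y (f t (Y t) - k ^ 2 • P (Y t)) (Icc 0 2) t) ∧
      Y 0 ∈ W ∧ ‖Y 0‖ = 1 ∧ ‖L (Y 2)‖ ≤ 2 * (1 / ((j:ℝ) + 1)) := by
    intro j
    obtain ⟨k, hk, hk', Y, hY, hW, hL, hlt⟩ := hcon ((j:ℝ) + 1) (by positivity)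
      (1 / ((j:ℝ) + 1)) (by positivity)
    have hpos : 0 < ‖Y 0‖ := lt_trans (by positivity) hlt
    refine ⟨k, hk, hk', fun t => ‖Y 0‖⁻¹ • Y t, fun t ht => ?_, W.smul_mem _ hW, ?_, ?_⟩
    · have := (hY t ht).const_smul (‖Y 0‖⁻¹)
      rw [hhom, map_smul, smul_comm (k ^ 2), ← smul_sub]
      exact this
    · rw [norm_smul, norm_inv, norm_norm, inv_mul_cancel₀ hpos.ne']
    · rw [map_smul, norm_smul, norm_inv, norm_norm, inv_mul_le_iff₀ hpos]
      refine hL.trans ?_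
      have : k ≤ ‖Y 0‖ / ((j:ℝ) + 1) := by
        rw [le_div_iff₀ (by positivity)]; linarith
      calc 2 * k ≤ 2 * (‖Y 0‖ / ((j:ℝ) + 1)) := by gcongr
        _ = _ := by ring
  choose k hk hk' Y hY hW hn hL using hseq
  have hk1 : ∀ j, k j ≤ 1 := fun j => (hk' j).le.trans (by
    rw [div_le_one (by positivity)]; linarith [(Nat.cast_nonneg j : (0:ℝ) ≤ j)])
  have hkt : Tendsto k atTop (𝓝 0) :=
    squeeze_zero (fun j => (hk j).le) (fun j => (hk' j).le) tendsto_one_div_add_atTop_nhds_zero_nat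
  obtain ⟨c, hc, σ, hσ, hσt⟩ := (isCompact_sphere (0:E) 1).tendsto_subseq (x := fun j => Y j 0)
    (fun j => by simp [hn])
  have hYb : ∀ j, ∀ t ∈ Icc (0:ℝ) 2, ‖Y j t‖ ≤ Real.exp (R * 2) := fun j t ht => by
    simpa [hn] using hgr (k j) (hk j) (hk1 j) (Y j) (hY j) t ht
  obtain ⟨Z, hZ, hZ0, hZl⟩ := limit_traj f hf K hK1 hK (fun j => Y (σ j))
    (fun j t => f t (Y (σ j) t) - (k (σ j)) ^ 2 • P (Y (σ j) t))
    (fun j => (k (σ j)) ^ 2 * (‖P‖ * Real.exp (R * 2)))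
    (by
      have : Tendsto (fun j => k (σ j)) atTop (𝓝 0) := hkt.comp hσ.tendsto_atTop
      simpa using (this.pow 2).mul_const (‖P‖ * Real.exp (R * 2)))
    (R * Real.exp (R * 2)) (fun j => hY (σ j))
    (fun j => by
      have h1 : ContinuousOn (Y (σ j)) (Icc 0 2) := fun t ht => (hY _ t ht).continuousWithinAt
      have h2 : ContinuousOn (fun t => f t (Y (σ j) t)) (Icc 0 2) :=
        hf.comp_continuousOn (continuousOn_id.prodMk h1)
      exact h2.sub ((P.continuous.comp_continuousOn h1).const_smul _))
    (fun j t ht => (hder _ (hk _) (hk1 _) t _).trans (by have := hYb (σ j) t ht; gcongr))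
    (fun j t ht => by
      rw [sub_sub_cancel_left, norm_neg, norm_smul, Real.norm_of_nonneg (by positivity)]
      have := hYb (σ j) t ht
      have h2 := P.le_opNorm (Y (σ j) t)
      gcongr
      exact h2.trans (by gcongr))
    c hσt
  have hc0 : Z 0 = 0 := by
    refine hinj Z hZ ?_ ?_
    · rw [hZ0]
      exact W.closed_of_finiteDimensional.mem_of_tendsto hσt (Eventually.of_forall fun j => hW _)
    · have h1 : Tendsto (fun j => L (Y (σ j) 2)) atTop (𝓝 (L (Z 2))) :=
        (L.continuous.tendsto _).comp (hZl 2 (by simp))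
      have h2 : Tendsto (fun j => L (Y (σ j) 2)) atTop (𝓝 0) := by
        refine squeeze_zero_norm (fun j => hL (σ j)) ?_
        have : Tendsto (fun j : ℕ => 2 * (1 / ((j:ℝ) + 1))) atTop (𝓝 (2 * 0)) :=
          (tendsto_one_div_add_atTop_nhds_zero_nat).const_mul 2
        rw [mul_zero] at this
        exact this.comp hσ.tendsto_atTop
      exact tendsto_nhds_unique h1 h2
  rw [hZ0] at hc0
  simp [hc0] at hc

/-- Data at the vertex compatible with continuity and the Kirchhoff condition. -/
def vertexSub (d : ℕ) : Submodule ℝ ((Fin d → ℂ) × (Fin d → ℂ)) where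
  carrier := {x | (∀ n n', x.1 n = x.1 n') ∧ ∑ n, x.2 n = 0}
  add_mem' := by
    rintro x y ⟨h1, h2⟩ ⟨h3, h4⟩
    refine ⟨fun n n' => ?_, ?_⟩
    · simp [h1 n n', h3 n n']
    · simp [Finset.sum_add_distrib, h2, h4]
  zero_mem' := by simp
  smul_mem' := by
    rintro c x ⟨h1, h2⟩
    refine ⟨fun n n' => ?_, ?_⟩
    · simp [h1 n n']
    · simp [← Finset.mul_sum, h2]

/-- The first order vector field. -/
def vfield (d : ℕ) (B : Fin d → ℝ → ℝ) (t : ℝ) (x : (Fin d → ℂ) × (Fin d → ℂ)) :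
    (Fin d → ℂ) × (Fin d → ℂ) := (x.2, fun n => (B n t : ℂ) * x.1 n)

lemma vfield_lip (d : ℕ) (B : Fin d → ℝ → ℝ) (K : NNReal) (hK1 : 1 ≤ K)
    (hB : ∀ n t, |B n t| ≤ K) (t : ℝ) : LipschitzWith K (vfield d B t) := by
  have hK1' : (1:ℝ) ≤ K := by exact_mod_cast hK1
  refine LipschitzWith.of_dist_le_mul fun x y => ?_
  rw [dist_eq_norm, dist_eq_norm]
  have h1 : ‖x.1 - y.1‖ ≤ ‖x - y‖ := norm_fst_le (x - y)
  have h2 : ‖x.2 - y.2‖ ≤ ‖x - y‖ := norm_snd_le (x - y)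
  refine norm_prod_le_iff.2 ⟨?_, ?_⟩
  · change ‖x.2 - y.2‖ ≤ _
    exact h2.trans (le_mul_of_one_le_left (norm_nonneg _) hK1')
  · refine (pi_norm_le_iff_of_nonneg (by positivity)).2 fun n => ?_
    have e : (vfield d B t x - vfield d B t y).2 n = (B n t : ℂ) * (x.1 - y.1) n := by
      simp [vfield, mul_sub]
    rw [e, norm_mul, Complex.norm_real, Real.norm_eq_abs]
    exact mul_le_mul (hB n t) ((norm_le_pi_norm _ n).trans h1) (norm_nonneg _) K.2

lemma scat_deriv {d : ℕ} {B : Fin d → ℝ → ℝ} (hBcont : ∀ n, Continuous (B n))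
    {k : ℝ} {φ : Fin d → ℝ → ℂ} (h : IsStarSolution d B k φ) (n : Fin d) (s : ℝ) (hs : 0 ≤ s) :
    HasDerivWithinAt (φ n) (derivWithin (φ n) (Ici 0) s) (Ici 0) s ∧
    HasDerivWithinAt (derivWithin (φ n) (Ici 0))
      ((B n s : ℂ) * φ n s - (k:ℂ) ^ 2 * φ n s) (Ici 0) s := by
  obtain ⟨h2, hode, -, -⟩ := h
  have hu : UniqueDiffOn ℝ (Ici (0:ℝ)) := uniqueDiffOn_Ici 0
  have hd := (contDiffOn_succ_iff_derivWithin (n := 1) hu).1 (by simpa [one_add_one_eq_two] using h2 n)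
  have hd1 := (contDiffOn_one_iff_derivWithin hu).1 hd.2.2
  refine ⟨(hd.1 s hs).hasDerivWithinAt, ?_⟩
  have key : EqOn (derivWithin (derivWithin (φ n) (Ici 0)) (Ici 0))
      (fun s => (B n s : ℂ) * φ n s - (k:ℂ) ^ 2 * φ n s) (Ioi 0) := by
    intro x hx
    have hx' : (0:ℝ) < x := hx
    have e1 : derivWithin (φ n) (Ici 0) =ᶠ[nhds x] deriv (φ n) := by
      filter_upwards [Ioi_mem_nhds hx'] with y hy
      exact derivWithin_of_mem_nhds (Ici_mem_nhds hy)
    beta_reduce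
    rw [derivWithin_of_mem_nhds (Ici_mem_nhds hx'), e1.deriv_eq]
    linear_combination -(hode n x hx)
  have hcφ : ContinuousOn (φ n) (Ici 0) := (h2 n).continuousOn
  have hBc : Continuous (fun s => (B n s : ℂ)) := Complex.continuous_ofReal.comp (hBcont n)
  have key2 := key.of_subset_closure hd1.2
    ((hBc.continuousOn.mul hcφ).sub (continuousOn_const.mul hcφ)) Ioi_subset_Ici_self
    (by rw [closure_Ioi])
  have := (hd1.1 s hs).hasDerivWithinAt
  rw [key2 hs] at this
  exact this

lemma scat_end {d : ℕ} {B : Fin d → ℝ → ℝ} {k : ℝ} (hk : 0 < k) {m : Fin d} {t : Fin d → ℂ}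
    {φ : Fin d → ℝ → ℂ} (h : IsScatteringSolution d B k m t φ) (ht : ∀ n, ‖t n‖ ≤ 1) (n : Fin d) :
    ‖derivWithin (φ n) (Ici 0) 2‖ ≤ 2 * k := by
  have e : φ n =ᶠ[nhds 2] fun s : ℝ =>
      (if n = m then 1 else 0) * Complex.exp (-(Complex.I * k * s))
            + t n * Complex.exp (Complex.I * k * s) := by
    filter_upwards [Ioi_mem_nhds (show (1:ℝ) < 2 by norm_num)] with y hy
    exact h.2 n y (le_of_lt hy)
  have hlin : HasDerivAt (fun s : ℝ => Complex.I * k * (s:ℂ)) (Complex.I * k) 2 := by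
    simpa using (Complex.ofRealCLM.hasDerivAt (x := (2:ℝ))).const_mul (Complex.I * k)
  have hder := ((hlin.neg.cexp).const_mul (if n = m then (1:ℂ) else 0)).add
    ((hlin.cexp).const_mul (t n))
  rw [derivWithin_of_mem_nhds (Ici_mem_nhds (by norm_num)), e.deriv_eq]
  have hder' := hder.deriv
  simp only [Pi.add_def, Pi.neg_def] at hder'
  rw [hder']
  have n1 : ‖Complex.exp (Complex.I * k * ((2:ℝ):ℂ))‖ = 1 := by
    rw [Complex.norm_exp]; simp
  have n2 : ‖Complex.exp (-(Complex.I * k * ((2:ℝ):ℂ)))‖ = 1 := by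
    rw [Complex.norm_exp]; simp
  refine (norm_add_le _ _).trans ?_
  simp only [norm_mul, norm_neg, n1, n2, Complex.norm_I, Complex.norm_real, Real.norm_eq_abs,
    abs_of_pos hk]
  have h3 : ‖(if n = m then (1:ℂ) else 0)‖ ≤ 1 := by split_ifs <;> simp
  nlinarith [ht n]

lemma neumann_inj (d : ℕ) (hd : 2 ≤ d)
    (B : Fin d → ℝ → ℝ) (hBcont : ∀ n, Continuous (B n))
    (hNeumann : ∀ φ : Fin d → ℝ → ℂ,
      (∀ n, ContDiffOn ℝ 2 (φ n) (Icc 0 2)) →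
      (∀ n, ∀ s ∈ Ioo (0 : ℝ) 2,
        -(deriv (deriv (φ n)) s) + (B n s : ℂ) * φ n s = 0) →
      (∀ n n' : Fin d, φ n 0 = φ n' 0) →
      (∑ n, derivWithin (φ n) (Icc (0 : ℝ) 2) 0 = 0) →
      (∀ n, derivWithin (φ n) (Icc (0 : ℝ) 2) 2 = 0) →
      ∀ n, ∀ s ∈ Icc (0 : ℝ) 2, φ n s = 0)
    (Y : ℝ → (Fin d → ℂ) × (Fin d → ℂ))
    (hY : ∀ t ∈ Icc (0:ℝ) 2, HasDerivWithinAt Y (vfield d B t (Y t)) (Icc 0 2) t)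
    (hW : Y 0 ∈ vertexSub d) (hL : (Y 2).2 = 0) : Y 0 = 0 := by
  have hu : UniqueDiffOn ℝ (Icc (0:ℝ) 2) := uniqueDiffOn_Icc (by norm_num)
  have h1 : ∀ n, ∀ t ∈ Icc (0:ℝ) 2,
      HasDerivWithinAt (fun s => (Y s).1 n) ((Y t).2 n) (Icc 0 2) t := fun n t ht =>
    (hasDerivWithinAt_pi.1 (hY t ht).fst) n
  have h2 : ∀ n, ∀ t ∈ Icc (0:ℝ) 2,
      HasDerivWithinAt (fun s => (Y s).2 n) ((B n t : ℂ) * (Y t).1 n) (Icc 0 2) t := fun n t ht =>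
    (hasDerivWithinAt_pi.1 (hY t ht).snd) n
  have d1 : ∀ n, ∀ t ∈ Icc (0:ℝ) 2, derivWithin (fun s => (Y s).1 n) (Icc 0 2) t = (Y t).2 n :=
    fun n t ht => (h1 n t ht).derivWithin (hu t ht)
  have d2 : ∀ n, ∀ t ∈ Icc (0:ℝ) 2,
      derivWithin (fun s => (Y s).2 n) (Icc 0 2) t = (B n t : ℂ) * (Y t).1 n :=
    fun n t ht => (h2 n t ht).derivWithin (hu t ht)
  have m0 : (0:ℝ) ∈ Icc (0:ℝ) 2 := by simp
  have m2 : (2:ℝ) ∈ Icc (0:ℝ) 2 := by simp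
  have hz := hNeumann (fun n s => (Y s).1 n) (fun n => ?_) (fun n s hs => ?_) hW.1 ?_ ?_
  · have a1 : ∀ n, (Y 0).1 n = 0 := fun n => hz n 0 m0
    have a2 : ∀ n, (Y 0).2 n = 0 := fun n => by
      rw [← d1 n 0 m0, derivWithin_congr (f := fun _ => (0:ℂ)) (fun s hs => hz n s hs) (hz n 0 m0)]
      simp
    exact Prod.ext (funext a1) (funext a2)
  · have c1 : ContDiffOn ℝ 1 (fun s => (Y s).2 n) (Icc 0 2) := by
      refine (contDiffOn_one_iff_derivWithin hu).2
        ⟨fun t ht => (h2 n t ht).differentiableWithinAt, ?_⟩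
      have hBc : Continuous (fun s => (B n s : ℂ)) := Complex.continuous_ofReal.comp (hBcont n)
      refine ContinuousOn.congr ?_ (d2 n)
      exact hBc.continuousOn.mul (fun t ht => (h1 n t ht).continuousWithinAt)
    have := (contDiffOn_succ_iff_derivWithin (n := 1) hu (f := fun s => (Y s).1 n)).2
      ⟨fun t ht => (h1 n t ht).differentiableWithinAt, by simp, c1.congr (d1 n)⟩
    simpa [one_add_one_eq_two] using this
  · have e1 : deriv (fun s => (Y s).1 n) =ᶠ[nhds s] fun s => (Y s).2 n := by
      filter_upwards [Ioo_mem_nhds hs.1 hs.2] with y hy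
      exact ((h1 n y (Ioo_subset_Icc_self hy)).hasDerivAt (Icc_mem_nhds hy.1 hy.2)).deriv
    beta_reduce
    rw [e1.deriv_eq,
      ((h2 n s (Ioo_subset_Icc_self hs)).hasDerivAt (Icc_mem_nhds hs.1 hs.2)).deriv]
    ring
  · rw [← hW.2]
    exact Finset.sum_congr rfl fun n _ => d1 n 0 m0
  · intro n
    rw [d1 n 2 m2, hL]; rfl

/-- If zero is not an eigenvalue of the Neumann problem on the truncated star graph
`[0,2]`, then near the bottom of the spectrum the scattering solutions are small on `[0,2]`:
there are `C > 0`, `k₀ > 0` such that for all `0 < k < k₀` and every scattering solution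
with coefficients `|t_{n,m}| ≤ 1`, one has `|φ^{(m)}ₙ(s)| ≤ C·k` for all `n` and
`s ∈ [0,2]`.  In particular the values of the scattering solutions at the vertex tend to
zero as `k → 0`. -/
theorem scattering_solution_small_near_bottom
    (d : ℕ) (hd : 2 ≤ d)
    (B : Fin d → ℝ → ℝ) (hBcont : ∀ n, Continuous (B n))
    (hBsupp : ∀ n, ∀ s : ℝ, s ∉ Icc (0 : ℝ) 1 → B n s = 0)
    (hNeumann : ∀ φ : Fin d → ℝ → ℂ,
      (∀ n, ContDiffOn ℝ 2 (φ n) (Icc 0 2)) →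
      (∀ n, ∀ s ∈ Ioo (0 : ℝ) 2,
        -(deriv (deriv (φ n)) s) + (B n s : ℂ) * φ n s = 0) →
      (∀ n n' : Fin d, φ n 0 = φ n' 0) →
      (∑ n, derivWithin (φ n) (Icc (0 : ℝ) 2) 0 = 0) →
      (∀ n, derivWithin (φ n) (Icc (0 : ℝ) 2) 2 = 0) →
      ∀ n, ∀ s ∈ Icc (0 : ℝ) 2, φ n s = 0) :
    ∃ C > (0 : ℝ), ∃ k₀ > (0 : ℝ), ∀ k : ℝ, 0 < k → k < k₀ →
      ∀ (m : Fin d) (t : Fin d → ℂ) (φ : Fin d → ℝ → ℂ),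
        IsScatteringSolution d B k m t φ →
        (∀ n, ‖t n‖ ≤ 1) →
        ∀ n, ∀ s ∈ Icc (0 : ℝ) 2, ‖φ n s‖ ≤ C * k := by
  have hb : ∀ n, ∃ b, ∀ t, ‖B n t‖ ≤ b := fun n => by
    refine HasCompactSupport.exists_bound_of_continuous ?_ (hBcont n)
    exact HasCompactSupport.intro isCompact_Icc (fun s hs => hBsupp n s hs)
  choose b hb using hb
  let K : NNReal := 1 + ∑ n, (b n).toNNReal
  have hK1 : 1 ≤ K := le_self_add
  have hBK : ∀ n t, |B n t| ≤ K := fun n t => by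
    have h1 : (b n).toNNReal ≤ K :=
      (Finset.single_le_sum (f := fun n => (b n).toNNReal) (fun _ _ => zero_le)
        (Finset.mem_univ n)).trans le_add_self
    calc |B n t| ≤ b n := hb n t
      _ ≤ ((b n).toNNReal : ℝ) := Real.le_coe_toNNReal _
      _ ≤ K := by exact_mod_cast h1
  have hcont : Continuous (fun p : ℝ × ((Fin d → ℂ) × (Fin d → ℂ)) => vfield d B p.1 p.2) := by
    unfold vfield
    refine Continuous.prodMk (by fun_prop) (continuous_pi fun n => ?_)
    have := hBcont n
    fun_prop
  obtain ⟨C, hC, k₀, hk₀, H⟩ := core_bound (vfield d B) hcont K hK1 (vfield_lip d B K hK1 hBK)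
    (fun t a x => by
      refine Prod.ext rfl (funext fun n => ?_)
      simp [vfield]; ring)
    ((ContinuousLinearMap.inr ℝ (Fin d → ℂ) (Fin d → ℂ)).comp
      (ContinuousLinearMap.fst ℝ (Fin d → ℂ) (Fin d → ℂ)))
    (ContinuousLinearMap.snd ℝ (Fin d → ℂ) (Fin d → ℂ)) (vertexSub d)
    (fun Y hY hW hL => neumann_inj d hd B hBcont hNeumann Y hY hW hL)
  refine ⟨C, hC, k₀, hk₀, fun k hk hkk m t φ hφ ht n s hs => ?_⟩
  have := H k hk hkk (fun s => (fun n => φ n s, fun n => derivWithin (φ n) (Ici 0) s)) ?_ ?_ ?_ s hs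
  · refine (norm_le_pi_norm (fun n => φ n s) n).trans (le_trans ?_ this)
    exact norm_fst_le ((fun n => φ n s, fun n => derivWithin (φ n) (Ici 0) s) :
      (Fin d → ℂ) × (Fin d → ℂ))
  · intro s hs
    have h1 : HasDerivWithinAt (fun s => fun n => φ n s)
        (fun n => derivWithin (φ n) (Ici 0) s) (Icc 0 2) s :=
      hasDerivWithinAt_pi.2 fun n => (scat_deriv hBcont hφ.1 n s hs.1).1.mono Icc_subset_Ici_self
    have h2 : HasDerivWithinAt (fun s => fun n => derivWithin (φ n) (Ici 0) s)
        (fun n => (B n s : ℂ) * φ n s - (k:ℂ) ^ 2 * φ n s) (Icc 0 2) s :=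
      hasDerivWithinAt_pi.2 fun n => (scat_deriv hBcont hφ.1 n s hs.1).2.mono Icc_subset_Ici_self
    convert! h1.prodMk h2 using 1
    refine Prod.ext (funext fun n => ?_) (funext fun n => ?_)
    · simp [vfield]
    · simp [vfield]
  · exact ⟨hφ.1.2.2.1, hφ.1.2.2.2⟩
  · exact (pi_norm_le_iff_of_nonneg (by positivity)).2 fun n => scat_end hk hφ ht n
end
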